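/- arXiv:1201.0043 — 18 statements merged into one kernel-verified Lean document; each statement's English description precedes it below -/
import Mathlib

section
/- For any finite simple graph G, the complement of the 4-subdivision Subd_4(G) is a 2-interval graph; that is, there exists a 2-interval representation of the complement of Subd_4(G). -/
/-- A `t`-interval representation of a graph `G`: each vertex `v` gets `t` closed bounded
intervals `[lo i v, hi i v]`, and two distinct vertices are adjacent iff the unions of their
intervals intersect. -/
def IsTIntervalRep {V : Type*} (t : ℕ) (G : SimpleGraph V) (lo hi : Fin t → V → ℝ) : Prop :=
  (∀ i v, lo i v ≤ hi i v) ∧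
  ∀ u v : V, u ≠ v →
    (G.Adj u v ↔
      ((⋃ i, Set.Icc (lo i u) (hi i u)) ∩ ⋃ j, Set.Icc (lo j v) (hi j v)).Nonempty)

/-- The `w`-subdivision of `G`, where each edge `e` (with chosen endpoints `l e` and `r e`)
is replaced by the path `l e, (e,1), …, (e,w), r e`. -/
def Subd {V : Type*} (w : ℕ) (G : SimpleGraph V) (l r : G.edgeSet → V) :
    SimpleGraph (V ⊕ (G.edgeSet × Fin w)) :=
  SimpleGraph.fromRel fun a b =>
    match a, b with
    | Sum.inl v, Sum.inr (e, i) => (i.val = 0 ∧ v = l e) ∨ (i.val = w - 1 ∧ v = r e)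
    | Sum.inr (e, i), Sum.inr (e', j) => e = e' ∧ i.val + 1 = j.val
    | _, _ => False

/-- Left endpoints of the representation. -/
def sdLo {V E : Type*} (l r : E → V) (X : V → ℤ) (c : E → ℤ) (H K : ℤ) :
    Fin 2 → (V ⊕ (E × Fin 4)) → ℤ
  | 0, Sum.inl v => X v - K
  | 1, Sum.inl v => X v - K
  | 0, Sum.inr (_, 0) => -3 * K
  | 1, Sum.inr (e, 0) => X (l e) + 2 * c e + K + 1
  | 0, Sum.inr (e, 1) => X (l e) + 2 * c e - H - K
  | 1, Sum.inr (e, 1) => X (l e) + 2 * c e + 1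
  | 0, Sum.inr (e, 2) => X (r e) + 2 * c e - H - K
  | 1, Sum.inr (e, 2) => X (l e) + 2 * c e + K + 1
  | 0, Sum.inr (_, 3) => -3 * K
  | 1, Sum.inr (e, 3) => X (r e) + 2 * c e + K + 1

/-- Right endpoints of the representation. -/
def sdHi {V E : Type*} (l r : E → V) (X : V → ℤ) (c : E → ℤ) (H K : ℤ) :
    Fin 2 → (V ⊕ (E × Fin 4)) → ℤ
  | 0, Sum.inl v => X v + K
  | 1, Sum.inl v => X v + K
  | 0, Sum.inr (e, 0) => X (l e) + 2 * c e - H - K - 1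
  | 1, Sum.inr (_, 0) => 3 * K
  | 0, Sum.inr (e, 1) => X (l e) + 2 * c e - H - K
  | 1, Sum.inr (e, 1) => X (l e) + 2 * c e + K
  | 0, Sum.inr (e, 2) => X (l e) + 2 * c e
  | 1, Sum.inr (e, 2) => X (r e) + 2 * c e + K
  | 0, Sum.inr (e, 3) => X (r e) + 2 * c e - H - K - 1
  | 1, Sum.inr (_, 3) => 3 * K

/-- Nonadjacency relation between nodes, one direction. -/
def sdRel {V E : Type*} (l r : E → V) : (V ⊕ (E × Fin 4)) → (V ⊕ (E × Fin 4)) → Prop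
  | Sum.inl v, Sum.inr (e, i) => (i.val = 0 ∧ v = l e) ∨ (i.val = 4 - 1 ∧ v = r e)
  | Sum.inr (e, i), Sum.inr (e', j) => e = e' ∧ i.val + 1 = j.val
  | _, _ => False

theorem sd_core {V E : Type*} (l r : E → V) (X : V → ℤ) (c : E → ℤ) (H K : ℤ)
    (hX : ∀ u v, u = v ∨ X u + 2 * H ≤ X v ∨ X v + 2 * H ≤ X u)
    (hX0 : ∀ v, 0 ≤ X v) (hXK : ∀ v, X v + 2 * H ≤ K) (hH : 0 < H)
    (hc : ∀ e f, c e = c f → e = f) (hc0 : ∀ e, 1 ≤ c e) (hcH : ∀ e, 2 * c e < H)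
    (hlr : ∀ e, X (l e) < X (r e)) (u v : V ⊕ (E × Fin 4)) (huv : u ≠ v) :
    (¬ (sdRel l r u v ∨ sdRel l r v u)) ↔
      ∃ i j, sdLo l r X c H K i u ≤ sdHi l r X c H K j v ∧
        sdLo l r X c H K j v ≤ sdHi l r X c H K i u := by
  have key : ∀ w e, (w = l e → X w = X (l e)) ∧ (w = r e → X w = X (r e)) := by
    intro w e; exact ⟨fun h => by rw [h], fun h => by rw [h]⟩
  have hVE : ∀ w e, ∀ k : Fin 4, 
      (¬ (sdRel l r (Sum.inl w) (Sum.inr (e, k)) ∨ sdRel l r (Sum.inr (e, k)) (Sum.inl w))) ↔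
      ∃ i j, sdLo l r X c H K i (Sum.inl w) ≤ sdHi l r X c H K j (Sum.inr (e, k)) ∧
        sdLo l r X c H K j (Sum.inr (e, k)) ≤ sdHi l r X c H K i (Sum.inl w) := by
    intro w e k
    have h1 := key w e
    have h2 := hX w (l e)
    have h3 := hX w (r e)
    have := hX0 w; have := hXK w; have := hX0 (l e); have := hXK (l e)
    have := hX0 (r e); have := hXK (r e); have := hc0 e; have := hcH e; have := hlr e
    fin_cases k <;> simp [sdRel, sdLo, sdHi, Fin.exists_fin_two] <;> grind
  rcases u with w | ⟨e, k⟩ <;> rcases v with w' | ⟨f, m⟩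
  · have := hX0 w; have := hXK w; have := hX0 w'; have := hXK w'
    simp [sdRel, sdLo, sdHi, Fin.exists_fin_two]; omega
  · exact hVE _ _ _
  · rw [or_comm, hVE, exists_comm]
    simp only [and_comm]
  · have := hX0 (l e); have := hXK (l e)
    have := hX0 (r e); have := hXK (r e); have := hc0 e; have := hcH e; have := hlr e
    by_cases hef : e = f
    · subst hef
      fin_cases k <;> fin_cases m <;>
        first
        | exact absurd rfl huv
        | (simp [sdRel, sdLo, sdHi, Fin.exists_fin_two]; omega)
    · have hcc : c e ≠ c f := fun h => hef (hc _ _ h)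
      have := hX0 (l f); have := hXK (l f)
      have := hX0 (r f); have := hXK (r f); have := hc0 f; have := hcH f; have := hlr f
      have hsep : ∀ a b, X a = X b ∨ X a + 2 * H ≤ X b ∨ X b + 2 * H ≤ X a := by
        intro a b
        rcases hX a b with h | h
        · left; rw [h]
        · right; exact h
      have a1 := hsep (l e) (l f)
      have a2 := hsep (l e) (r f)
      have a3 := hsep (r e) (l f)
      have a4 := hsep (r e) (r f)
      clear hVE key hX
      fin_cases k <;> fin_cases m <;>
        simp [sdRel, sdLo, sdHi, Fin.exists_fin_two, hef, Ne.symm hef] <;> omega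

/-- Reverse the subdivided edges on which `P` holds. -/
noncomputable def sdFlip {V E : Type*} (P : E → Prop) :
    (V ⊕ (E × Fin 4)) → (V ⊕ (E × Fin 4))
  | Sum.inl v => Sum.inl v
  | Sum.inr (e, i) => Sum.inr (e, open Classical in if P e then Fin.rev i else i)

theorem sdFlip_inj {V E : Type*} (P : E → Prop) :
    Function.Injective (sdFlip (V := V) P) := by
  rintro (u | ⟨e, i⟩) (v | ⟨f, j⟩) h
  · simpa [sdFlip] using h
  · simp [sdFlip] at h
  · simp [sdFlip] at h
  · simp only [sdFlip, Sum.inr.injEq, Prod.mk.injEq] at h ⊢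
    obtain ⟨rfl, h⟩ := h
    refine ⟨rfl, ?_⟩
    split_ifs at h
    · exact Fin.rev_injective h
    · exact h

open Classical in
theorem sdFlip_rel {V E : Type*} (P : E → Prop) (l r : E → V) (u v : V ⊕ (E × Fin 4)) :
    (sdRel (fun e => if P e then r e else l e) (fun e => if P e then l e else r e)
        (sdFlip P u) (sdFlip P v) ∨
      sdRel (fun e => if P e then r e else l e) (fun e => if P e then l e else r e)
        (sdFlip P v) (sdFlip P u)) ↔ (sdRel l r u v ∨ sdRel l r v u) := by
  rcases u with u | ⟨e, i⟩ <;> rcases v with v | ⟨f, j⟩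
  · simp [sdRel, sdFlip]
  · by_cases h : P f <;> simp [sdRel, sdFlip, h] <;> grind
  · by_cases h : P e <;> simp [sdRel, sdFlip, h] <;> grind
  · by_cases hef : e = f
    · subst hef
      by_cases h : P e <;> simp [sdRel, sdFlip, h] <;> omega
    · simp [sdRel, sdFlip, hef, Ne.symm hef]

theorem sd_adj {V : Type*} (G : SimpleGraph V) (l r : G.edgeSet → V)
    (u v : V ⊕ (G.edgeSet × Fin 4)) (huv : u ≠ v) :
    (Subd 4 G l r)ᶜ.Adj u v ↔ ¬ (sdRel l r u v ∨ sdRel l r v u) := by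
  rw [SimpleGraph.compl_adj, Subd, SimpleGraph.fromRel_adj]
  rcases u with u | ⟨e, i⟩ <;> rcases v with v | ⟨f, j⟩ <;> simp [sdRel] <;> simp_all

theorem sd_inter {W : Type*} (lo hi : Fin 2 → W → ℤ) (u v : W)
    (hu : ∀ i, lo i u ≤ hi i u) (hv : ∀ i, lo i v ≤ hi i v) :
    ((⋃ i, Set.Icc (lo i u : ℝ) (hi i u)) ∩ ⋃ j, Set.Icc (lo j v : ℝ) (hi j v)).Nonempty ↔
      ∃ i j, lo i u ≤ hi j v ∧ lo j v ≤ hi i u := by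
  constructor
  · rintro ⟨x, hx, hy⟩
    obtain ⟨i, hi⟩ := Set.mem_iUnion.1 hx
    obtain ⟨j, hj⟩ := Set.mem_iUnion.1 hy
    exact ⟨i, j, by exact_mod_cast hi.1.trans hj.2, by exact_mod_cast hj.1.trans hi.2⟩
  · rintro ⟨i, j, h1, h2⟩
    refine ⟨((max (lo i u) (lo j v) : ℤ) : ℝ), Set.mem_iUnion.2 ⟨i, ?_, ?_⟩,
      Set.mem_iUnion.2 ⟨j, ?_, ?_⟩⟩
    · exact_mod_cast le_max_left _ _
    · exact_mod_cast max_le (hu i) h2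
    · exact_mod_cast le_max_right _ _
    · exact_mod_cast max_le h1 (hv j)

theorem sd_valid {V E : Type*} (l r : E → V) (X : V → ℤ) (c : E → ℤ) (H K : ℤ)
    (hX0 : ∀ v, 0 ≤ X v) (hXK : ∀ v, X v + 2 * H ≤ K) (hH : 0 < H)
    (hc0 : ∀ e, 1 ≤ c e) (hcH : ∀ e, 2 * c e < H)
    (hlr : ∀ e, X (l e) < X (r e)) (i : Fin 2) (u : V ⊕ (E × Fin 4)) :
    sdLo l r X c H K i u ≤ sdHi l r X c H K i u := by
  rcases u with w | ⟨e, k⟩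
  · have := hX0 w; have := hXK w
    fin_cases i <;> simp [sdLo, sdHi] <;> omega
  · have := hX0 (l e); have := hXK (l e)
    have := hX0 (r e); have := hXK (r e); have := hc0 e; have := hcH e; have := hlr e
    fin_cases i <;> fin_cases k <;> simp [sdLo, sdHi] <;> omega

/-- For any finite simple graph `G`, the complement of `Subd₄(G)` is a 2-interval graph. -/
theorem subd4_compl_is_two_interval_graph {V : Type*} [Fintype V] (G : SimpleGraph V)
    (l r : G.edgeSet → V) (hlr : ∀ e : G.edgeSet, (e : Sym2 V) = s(l e, r e)) :
    ∃ lo hi : Fin 2 → (V ⊕ (G.edgeSet × Fin 4)) → ℝ,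
      IsTIntervalRep 2 (Subd 4 G l r)ᶜ lo hi := by
  classical
  obtain ⟨n, ⟨x⟩⟩ := Finite.exists_equiv_fin V
  obtain ⟨m, ⟨y⟩⟩ := Finite.exists_equiv_fin G.edgeSet
  have hne : ∀ e, l e ≠ r e := by
    intro e h
    have h1 := e.2
    rw [hlr e, h] at h1
    exact G.loopless.irrefl _ h1
  let H : ℤ := 2 * m + 2
  let K : ℤ := 2 * H * (n + 1)
  let X : V → ℤ := fun v => 2 * H * ((x v : ℕ) : ℤ)
  let c : G.edgeSet → ℤ := fun e => ((y e : ℕ) : ℤ) + 1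
  let P : G.edgeSet → Prop := fun e => X (r e) < X (l e)
  let l' : G.edgeSet → V := fun e => if P e then r e else l e
  let r' : G.edgeSet → V := fun e => if P e then l e else r e
  have hH : 0 < H := by simp only [H]; omega
  have hX : ∀ u v, u = v ∨ X u + 2 * H ≤ X v ∨ X v + 2 * H ≤ X u := by
    intro u v
    rcases lt_trichotomy (x u) (x v) with h | h | h
    · right; left
      have : ((x u : ℕ) : ℤ) + 1 ≤ ((x v : ℕ) : ℤ) := by exact_mod_cast h
      simp only [X]; nlinarith
    · left; exact x.injective h
    · right; right
      have : ((x v : ℕ) : ℤ) + 1 ≤ ((x u : ℕ) : ℤ) := by exact_mod_cast h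
      simp only [X]; nlinarith
  have hX0 : ∀ v, 0 ≤ X v := by intro v; simp only [X]; positivity
  have hXK : ∀ v, X v + 2 * H ≤ K := by
    intro v
    have : ((x v : ℕ) : ℤ) ≤ n := by exact_mod_cast (x v).2.le
    simp only [X, K]; nlinarith
  have hc : ∀ e f, c e = c f → e = f := by
    intro e f h
    apply y.injective
    apply Fin.ext
    simp only [c] at h
    omega
  have hc0 : ∀ e, 1 ≤ c e := by intro e; simp only [c]; omega
  have hcH : ∀ e, 2 * c e < H := by
    intro e
    have := (y e).2
    simp only [c, H]; omega
  have hlr' : ∀ e, X (l' e) < X (r' e) := by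
    intro e
    by_cases h : P e
    · simp only [l', r', if_pos h]; exact h
    · simp only [l', r', if_neg h]
      simp only [P] at h
      rcases hX (l e) (r e) with h1 | h1 | h1
      · exact absurd h1 (hne e)
      · omega
      · omega
  have hval := sd_valid l' r' X c H K hX0 hXK hH hc0 hcH hlr'
  refine ⟨fun i u => (sdLo l' r' X c H K i (sdFlip P u) : ℤ),
    fun i u => (sdHi l' r' X c H K i (sdFlip P u) : ℤ), ?_, ?_⟩
  · intro i v
    exact Int.cast_le.2 (hval i (sdFlip P v))
  · intro u v huv
    rw [sd_adj G l r u v huv, ← sdFlip_rel P l r u v]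
    rw [sd_inter (fun i u => sdLo l' r' X c H K i (sdFlip P u))
      (fun i u => sdHi l' r' X c H K i (sdFlip P u)) u v (fun i => hval i _) (fun i => hval i _)]
    convert sd_core l' r' X c H K hX hX0 hXK hH hc hc0 hcH hlr' _ _
      (fun h => huv (sdFlip_inj P h))
end

section
/- For any finite simple graph G, the complement of the 2-subdivision Subd_2(G) is a unit 3-interval graph; that is, there exists a 3-interval representation of the complement of Subd_2(G) in which all intervals have the same length. -/
/-- All intervals of the representation have the same length. -/
def IsUnitRep {V : Type*} (t : ℕ) (lo hi : Fin t → V → ℝ) : Prop :=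
  ∃ L : ℝ, ∀ i v, hi i v - lo i v = L

/-- Left endpoints of the intervals.  There are three far-apart regions, one for each pair of
classes (original vertices, first subdivision vertices, second subdivision vertices). -/
def posFn {V E : Type*} (f : V → ℤ) (g : E → ℤ) (l r : E → V) (L : ℤ) :
    Fin 3 → (V ⊕ (E × Fin 2)) → ℤ := fun i x =>
  match x with
  | Sum.inl v => ![f v, 2 * (10 * L + 10) + f v - (L + 1), 2 * (10 * L + 10) + f v + (L + 1)] i
  | Sum.inr (e, j) =>
    if j = 0 then ![f (l e) - (L + 1), f (l e) + (L + 1), (10 * L + 10) + g e] i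
    else ![(10 * L + 10) + g e - (L + 1), (10 * L + 10) + g e + (L + 1),
      2 * (10 * L + 10) + f (r e)] i

lemma inter_iff {W : Type*} (p : Fin 3 → W → ℤ) (L : ℤ) (hL : 0 ≤ L) (u v : W) :
    ((⋃ i, Set.Icc (p i u : ℝ) ((p i u : ℝ) + L)) ∩
      ⋃ j, Set.Icc (p j v : ℝ) ((p j v : ℝ) + L)).Nonempty ↔
      ∃ i j, p i u ≤ p j v + L ∧ p j v ≤ p i u + L := by
  constructor
  · rintro ⟨x, hx, hy⟩
    simp only [Set.mem_iUnion, Set.mem_Icc] at hx hy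
    obtain ⟨i, hi⟩ := hx
    obtain ⟨j, hj⟩ := hy
    refine ⟨i, j, ?_, ?_⟩
    · have : (p i u : ℝ) ≤ p j v + L := by linarith
      exact_mod_cast this
    · have : (p j v : ℝ) ≤ p i u + L := by linarith
      exact_mod_cast this
  · rintro ⟨i, j, h1, h2⟩
    have h1' : (p i u : ℝ) ≤ p j v + L := by exact_mod_cast h1
    have h2' : (p j v : ℝ) ≤ p i u + L := by exact_mod_cast h2
    have hL' : (0 : ℝ) ≤ L := by exact_mod_cast hL
    refine ⟨max (p i u) (p j v), ?_, ?_⟩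
    · simp only [Set.mem_iUnion, Set.mem_Icc]
      exact ⟨i, le_max_left _ _, max_le (by linarith) h2'⟩
    · simp only [Set.mem_iUnion, Set.mem_Icc]
      exact ⟨j, le_max_right _ _, max_le h1' (by linarith)⟩

lemma exists_inj_bdd (α : Type*) [Finite α] :
    ∃ (f : α → ℤ) (N : ℤ), Function.Injective f ∧ ∀ a, 0 ≤ f a ∧ f a < N := by
  obtain ⟨n, ⟨e⟩⟩ := Finite.exists_equiv_fin α
  refine ⟨fun a => ((e a : ℕ) : ℤ), n, ?_, fun a => ⟨by positivity, by have := (e a).2; dsimp only; omega⟩⟩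
  intro a b h
  exact e.injective (Fin.ext (by dsimp only at h; omega))

/-- For any finite simple graph `G`, the complement of `Subd₂(G)` is a unit 3-interval graph. -/
theorem subd2_compl_is_unit_three_interval_graph {V : Type*} [Fintype V] (G : SimpleGraph V)
    (l r : G.edgeSet → V) (hlr : ∀ e : G.edgeSet, (e : Sym2 V) = s(l e, r e)) :
    ∃ lo hi : Fin 3 → (V ⊕ (G.edgeSet × Fin 2)) → ℝ,
      IsTIntervalRep 3 (Subd 2 G l r)ᶜ lo hi ∧ IsUnitRep 3 lo hi := by
  obtain ⟨f, N, hf, hfN⟩ := exists_inj_bdd V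
  obtain ⟨g, M, hg, hgM⟩ := exists_inj_bdd G.edgeSet
  obtain ⟨L, hL, hNL, hML⟩ : ∃ L : ℤ, 0 ≤ L ∧ N ≤ L ∧ M ≤ L :=
    ⟨max 0 (max N M), by simp, by simp, by simp⟩
  refine ⟨fun i v => (posFn f g l r L i v : ℝ), fun i v => (posFn f g l r L i v : ℝ) + L,
    ⟨?_, ?_⟩, ⟨L, fun i v => by simp⟩⟩
  · intro i v
    have : (0 : ℝ) ≤ L := by exact_mod_cast hL
    simpa using this
  intro u v huv
  rw [inter_iff (posFn f g l r L) L hL, SimpleGraph.compl_adj]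
  rcases u with u | ⟨e, i⟩ <;> rcases v with v | ⟨e', j⟩
  · have h1 := hfN u
    have h2 := hfN v
    simp [Subd, SimpleGraph.fromRel_adj, posFn, huv, Fin.exists_fin_succ] at huv ⊢
    omega
  · have h1 := hfN u
    have h2 := hfN (l e')
    have h3 := hfN (r e')
    have h4 := hgM e'
    have h5 := hf.eq_iff (a := u) (b := l e')
    have h6 := hf.eq_iff (a := u) (b := r e')
    fin_cases j <;>
      simp [Subd, SimpleGraph.fromRel_adj, posFn, Fin.exists_fin_succ, ← h5, ← h6] <;> omega
  · have h1 := hfN v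
    have h2 := hfN (l e)
    have h3 := hfN (r e)
    have h4 := hgM e
    have h5 := hf.eq_iff (a := v) (b := l e)
    have h6 := hf.eq_iff (a := v) (b := r e)
    fin_cases i <;>
      simp [Subd, SimpleGraph.fromRel_adj, posFn, Fin.exists_fin_succ, ← h5, ← h6] <;> omega
  · have h1 := hfN (l e)
    have h2 := hfN (r e)
    have h3 := hfN (l e')
    have h4 := hfN (r e')
    have h5 := hgM e
    have h6 := hgM e'
    have h7 := hg.eq_iff (a := e) (b := e')
    have h8 := hg.eq_iff (a := e') (b := e)
    clear hlr
    fin_cases i <;> fin_cases j <;>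
      simp [Subd, SimpleGraph.fromRel_adj, posFn, Fin.exists_fin_succ, -Subtype.mk.injEq, ← h7, ← h8] at huv ⊢ <;> omega
end

section
/- For any finite simple graph G, the complement of the 2-subdivision Subd_2(G) is a 3-track graph; that is, there exists a 3-track representation of the complement of Subd_2(G). -/
/-- A `t`-track representation of a graph `G`: each vertex gets one closed bounded interval
`[lo i v, hi i v]` on each of `t` tracks, and two distinct vertices are adjacent iff their
intervals intersect on some track. -/
def IsTTrackRep {V : Type*} (t : ℕ) (G : SimpleGraph V) (lo hi : Fin t → V → ℝ) : Prop :=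
  (∀ i v, lo i v ≤ hi i v) ∧
  ∀ u v : V, u ≠ v →
    (G.Adj u v ↔ ∃ i, (Set.Icc (lo i u) (hi i u) ∩ Set.Icc (lo i v) (hi i v)).Nonempty)

/-- Left endpoints (integers; `C` is a common bound playing the role of infinity). -/
def trackLo {V E : Type*} (l r : E → V) (f : V → ℤ) (p : E → ℤ) (C : ℤ) :
    Fin 3 → (V ⊕ (E × Fin 2)) → ℤ
  | 0, Sum.inl v => -2 * f v
  | 0, Sum.inr (_, 0) => -2 * C - 2
  | 0, Sum.inr (e, 1) => 2 * f (r e) + 1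
  | 1, Sum.inl v => 2 * f v + 1
  | 1, Sum.inr (e, 0) => -2 * p e
  | 1, Sum.inr (_, 1) => -2 * C - 2
  | 2, Sum.inl v => 2 * f v + 1
  | 2, Sum.inr (_, 0) => -2 * C - 2
  | 2, Sum.inr (e, 1) => -2 * p e

/-- Right endpoints. -/
def trackHi {V E : Type*} (l r : E → V) (f : V → ℤ) (p : E → ℤ) (C : ℤ) :
    Fin 3 → (V ⊕ (E × Fin 2)) → ℤ
  | 0, Sum.inl v => 2 * f v
  | 0, Sum.inr (e, 0) => -2 * f (l e) - 1
  | 0, Sum.inr (_, 1) => 2 * C + 2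
  | 1, Sum.inl _ => 2 * C + 2
  | 1, Sum.inr (e, 0) => 2 * f (l e)
  | 1, Sum.inr (e, 1) => -2 * p e - 1
  | 2, Sum.inl _ => 2 * C + 2
  | 2, Sum.inr (e, 0) => -2 * p e - 1
  | 2, Sum.inr (e, 1) => 2 * f (r e)

theorem icc_inter_nonempty_iff {a b c d : ℤ} (h1 : a ≤ b) (h2 : c ≤ d) :
    (Set.Icc (a : ℝ) (b : ℝ) ∩ Set.Icc (c : ℝ) (d : ℝ)).Nonempty ↔ a ≤ d ∧ c ≤ b := by
  rw [Set.Icc_inter_Icc, Set.nonempty_Icc, sup_le_iff, le_inf_iff, le_inf_iff]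
  norm_cast
  tauto

theorem exists_bounded_code (α : Type*) [Finite α] :
    ∃ (f : α → ℤ) (C : ℤ), Function.Injective f ∧ ∀ a, 0 ≤ f a ∧ f a ≤ C := by
  obtain ⟨n, ⟨e⟩⟩ := Finite.exists_equiv_fin α
  refine ⟨fun a => ((e a : ℕ) : ℤ), n, ?_, fun a => ⟨by positivity, ?_⟩⟩
  · intro a b h
    have hab : ((e a : ℕ) : ℤ) = ((e b : ℕ) : ℤ) := h
    exact e.injective (Fin.ext (by exact_mod_cast hab))
  · have h : ((e a : ℕ) : ℤ) ≤ (n : ℤ) := by exact_mod_cast (e a).isLt.le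
    exact h

/-- For any finite simple graph `G`, the complement of `Subd₂(G)` is a 3-track graph. -/
theorem subd2_compl_is_three_track_graph {V : Type*} [Fintype V] (G : SimpleGraph V)
    (l r : G.edgeSet → V) (hlr : ∀ e : G.edgeSet, (e : Sym2 V) = s(l e, r e)) :
    ∃ lo hi : Fin 3 → (V ⊕ (G.edgeSet × Fin 2)) → ℝ,
      IsTTrackRep 3 (Subd 2 G l r)ᶜ lo hi := by
  obtain ⟨f, C₁, hf, hfC⟩ := exists_bounded_code V
  obtain ⟨p, C₂, hp, hpC⟩ := exists_bounded_code G.edgeSet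
  obtain ⟨C, hC1, hC2⟩ : ∃ C : ℤ, C₁ ≤ C ∧ C₂ ≤ C := ⟨max C₁ C₂, le_max_left _ _, le_max_right _ _⟩
  have hle : ∀ i v, trackLo l r f p C i v ≤ trackHi l r f p C i v := by
    intro i v
    rcases v with v | ⟨e, j⟩
    · have := hfC v
      fin_cases i <;> simp only [trackLo, trackHi] <;> omega
    · have := hfC (l e)
      have := hfC (r e)
      have := hpC e
      fin_cases i <;> fin_cases j <;> simp only [trackLo, trackHi] <;> omega
  refine ⟨fun i v => (trackLo l r f p C i v : ℝ), fun i v => (trackHi l r f p C i v : ℝ),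
    fun i v => Int.cast_le.mpr (hle i v), ?_⟩
  intro u v huv
  simp only [icc_inter_nonempty_iff (hle _ _) (hle _ _)]
  rw [SimpleGraph.compl_adj, Fin.exists_fin_succ, Fin.exists_fin_two]
  have key : ∀ a b : V, a = b ↔ f a = f b := fun a b => hf.eq_iff.symm
  have keyp : ∀ a b : G.edgeSet, a = b ↔ p a = p b := fun a b => hp.eq_iff.symm
  rcases u with u | ⟨e, i⟩ <;> rcases v with v | ⟨e', j⟩
  · have := hfC u
    have := hfC v
    simp [Subd, trackLo, trackHi, huv]
    omega
  · have := hfC u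
    have := hfC (l e')
    have := hfC (r e')
    have := hpC e'
    fin_cases j <;> simp [Subd, trackLo, trackHi, key] <;> omega
  · have := hfC v
    have := hfC (l e)
    have := hfC (r e)
    have := hpC e
    fin_cases i <;> simp [Subd, trackLo, trackHi, key] <;> omega
  · have := hfC (l e)
    have := hfC (r e)
    have := hpC e
    have := hfC (l e')
    have := hfC (r e')
    have := hpC e'
    fin_cases i <;> fin_cases j <;> simp [Subd, trackLo, trackHi, keyp] at huv ⊢ <;> omega
end

section
/- For any finite simple graph G, the complement of the 2-subdivision Subd_2(G) is a unit 4-track graph; that is, there exists a 4-track representation of the complement of Subd_2(G) in which all intervals have the same length. -/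
theorem aux_icc (x y L : ℤ) (hL : 0 ≤ L) :
    (Set.Icc (x : ℝ) ((x : ℝ) + L) ∩ Set.Icc (y : ℝ) ((y : ℝ) + L)).Nonempty ↔
      x ≤ y + L ∧ y ≤ x + L := by
  have hLR : (0 : ℝ) ≤ L := by exact_mod_cast hL
  constructor
  · rintro ⟨z, ⟨h1, h2⟩, h3, h4⟩
    constructor
    · have : (x : ℝ) ≤ y + L := by linarith
      exact_mod_cast this
    · have : (y : ℝ) ≤ x + L := by linarith
      exact_mod_cast this
  · rintro ⟨h1, h2⟩
    have hxy : (x : ℝ) ≤ y + L := by exact_mod_cast h1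
    have hyx : (y : ℝ) ≤ x + L := by exact_mod_cast h2
    rcases le_total (x : ℝ) y with h | h
    · exact ⟨y, ⟨h, hyx⟩, le_refl _, by linarith⟩
    · exact ⟨x, ⟨le_refl _, by linarith⟩, h, hxy⟩

/-- Well separated vertex values and refined edge values. -/
theorem aux_order {V E : Type*} [Finite V] [Finite E] (l : E → V) :
    ∃ (P : V → ℤ) (K : E → ℤ) (M W : ℤ), 0 ≤ M ∧ M ≤ W ∧
      (∀ v, 0 ≤ P v ∧ P v ≤ W) ∧ (∀ e, 0 ≤ K e ∧ K e ≤ W) ∧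
      (∀ u v, u = v ∨ P u + M + 1 ≤ P v ∨ P v + M + 1 ≤ P u) ∧
      (∀ e, P (l e) + 1 ≤ K e ∧ K e ≤ P (l e) + M) ∧
      (∀ e f, K e = K f → e = f) := by
  obtain ⟨n, ⟨p⟩⟩ := Finite.exists_equiv_fin V
  obtain ⟨m, ⟨q⟩⟩ := Finite.exists_equiv_fin E
  have sep : ∀ a b : ℤ, a < b → ((m : ℤ) + 1) * a + m + 1 ≤ (m + 1) * b := by
    intro a b h
    nlinarith
  have sepV : ∀ u v, u = v ∨ ((m : ℤ) + 1) * (p u : ℕ) + m + 1 ≤ (m + 1) * (p v : ℕ) ∨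
      ((m : ℤ) + 1) * (p v : ℕ) + m + 1 ≤ (m + 1) * (p u : ℕ) := by
    intro u v
    rcases lt_trichotomy (p u : ℕ) (p v : ℕ) with h | h | h
    · exact Or.inr (Or.inl (sep _ _ (by exact_mod_cast h)))
    · exact Or.inl (p.injective (Fin.ext h))
    · exact Or.inr (Or.inr (sep _ _ (by exact_mod_cast h)))
  have bd : ∀ v, 0 ≤ ((m : ℤ) + 1) * (p v : ℕ) ∧
      ((m : ℤ) + 1) * (p v : ℕ) ≤ (m + 1) * n := by
    intro v
    refine ⟨by positivity, ?_⟩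
    have : ((p v : ℕ) : ℤ) ≤ n := by exact_mod_cast (p v).2.le
    gcongr
  have hn : 0 ≤ ((m : ℤ) + 1) * n := by positivity
  refine ⟨fun v => (m + 1) * (p v : ℕ), fun e => (m + 1) * (p (l e) : ℕ) + (q e : ℕ) + 1,
    m, (m + 1) * n + m, by positivity, by linarith, ?_, ?_, sepV, ?_, ?_⟩
  · intro v
    have := bd v
    constructor <;> dsimp only <;> omega
  · intro e
    have := bd (l e)
    have := (q e).2
    constructor <;> dsimp only <;> omega
  · intro e
    have := (q e).2
    constructor <;> dsimp only <;> omega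
  · intro e f h
    dsimp only at h
    have h1 := (q e).2
    have h2 := (q f).2
    apply q.injective
    apply Fin.ext
    rcases sepV (l e) (l f) with h3 | h3 | h3
    · rw [h3] at h
      omega
    · omega
    · omega

/-- For any finite simple graph `G`, the complement of `Subd₂(G)` is a unit 4-track graph. -/
theorem subd2_compl_is_unit_four_track_graph {V : Type*} [Fintype V] (G : SimpleGraph V)
    (l r : G.edgeSet → V) (hlr : ∀ e : G.edgeSet, (e : Sym2 V) = s(l e, r e)) :
    ∃ lo hi : Fin 4 → (V ⊕ (G.edgeSet × Fin 2)) → ℝ,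
      IsTTrackRep 4 (Subd 2 G l r)ᶜ lo hi ∧ IsUnitRep 4 lo hi := by
  obtain ⟨P, K, M, W, hM, hMW, hP, hK, hsep, hKP, hinj⟩ := aux_order l
  obtain ⟨L, hL⟩ : ∃ L : ℤ, L = 10 * W + 10 := ⟨_, rfl⟩
  let pos : Fin 4 → (V ⊕ (G.edgeSet × Fin 2)) → ℤ := fun i x =>
    match i, x with
    | 0, Sum.inl v => P v
    | 0, Sum.inr (e, 0) => L + K e
    | 0, Sum.inr (e, 1) => 2 * L + K e + 1
    | 1, Sum.inl v => - P v
    | 1, Sum.inr (e, 0) => L - K e + M + 1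
    | 1, Sum.inr (e, 1) => 2 * L - K e + M + 2
    | 2, Sum.inl v => P v
    | 2, Sum.inr (_, 0) => 10 * L
    | 2, Sum.inr (e, 1) => L + P (r e) + 1
    | 3, Sum.inl v => - P v
    | 3, Sum.inr (_, 0) => 10 * L
    | 3, Sum.inr (e, 1) => L - P (r e) + 1
  have hL0 : 0 ≤ L := by omega
  refine ⟨fun i x => pos i x, fun i x => pos i x + L, ⟨?_, ?_⟩, L, ?_⟩
  · intro i v
    have : (0 : ℝ) ≤ L := by exact_mod_cast hL0
    simpa using this
  · intro u v huv
    simp only [aux_icc _ _ _ hL0]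
    rw [SimpleGraph.compl_adj]
    have key : (∃ i : Fin 4, pos i u ≤ pos i v + L ∧ pos i v ≤ pos i u + L) ↔
        ((pos 0 u ≤ pos 0 v + L ∧ pos 0 v ≤ pos 0 u + L) ∨
        (pos 1 u ≤ pos 1 v + L ∧ pos 1 v ≤ pos 1 u + L) ∨
        (pos 2 u ≤ pos 2 v + L ∧ pos 2 v ≤ pos 2 u + L) ∨
        (pos 3 u ≤ pos 3 v + L ∧ pos 3 v ≤ pos 3 u + L)) := by
      constructor
      · rintro ⟨i, h⟩
        fin_cases i <;> tauto
      · rintro (h | h | h | h)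
        exacts [⟨_, h⟩, ⟨_, h⟩, ⟨_, h⟩, ⟨_, h⟩]
    rw [key]
    simp only [Subd, SimpleGraph.fromRel_adj, huv, ne_eq, not_false_eq_true, true_and]
    -- arithmetic for the three kinds of mixed pairs
    have hVB : ∀ v e, v = l e ↔ ¬ (K e ≤ P v ∨ P v + M + 1 ≤ K e) := by
      intro v e
      have h1 := hKP e
      rcases hsep v (l e) with h | h | h
      · subst h; simp only [true_iff]; omega
      · constructor
        · rintro rfl; omega
        · intro; omega
      · constructor
        · rintro rfl; omega
        · intro; omega
    have hVC : ∀ v e, v = r e ↔ P v = P (r e) := by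
      intro v e
      refine ⟨fun h => by rw [h], fun h => ?_⟩
      rcases hsep v (r e) with hs | hs | hs
      · exact hs
      · omega
      · omega
    have hBC : ∀ e f, e = f ↔ K e = K f := fun e f => ⟨fun h => by rw [h], hinj e f⟩
    rcases u with u | ⟨e, i⟩ <;> rcases v with v | ⟨f, j⟩
    · have := hP u
      have := hP v
      simp [pos]
      omega
    · have := hP u
      have := hK f
      have := hP (r f)
      fin_cases j
      · simp [pos, hVB]
        omega
      · simp [pos, hVC]
        omega
    · have := hP v
      have := hK e
      have := hP (r e)
      fin_cases i
      · simp [pos, hVB]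
        omega
      · simp [pos, hVC]
        omega
    · have := hK e
      have := hK f
      have := hP (r e)
      have := hP (r f)
      fin_cases i <;> fin_cases j
      · simp [pos]
        omega
      · simp [pos, hBC]
        omega
      · simp [pos, hBC]
        omega
      · simp [pos]
        omega
  · intro i v
    simp
end

section
/- For any finite simple graph G, the complement of the 2-subdivision Subd_2(G) is a unit 2-circular interval graph; that is, there exist a circle ℝ/cℤ and a 2-circular interval representation of the complement of Subd_2(G) on it in which all arcs have the same length. -/
/-- The closed arc of length `d` starting at (the image of) `p` on the circle `ℝ/cℤ`. -/
def Arc (c : ℝ) (p d : ℝ) : Set (AddCircle c) :=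
  (fun x : ℝ => (x : AddCircle c)) '' Set.Icc p (p + d)

/-- A `t`-circular interval representation of `G` on the circle `ℝ/cℤ`: each vertex gets `t`
arcs (of length `< c`), and two distinct vertices are adjacent iff some arc of one intersects
some arc of the other. -/
def IsTCircIntervalRep {V : Type*} (t : ℕ) (G : SimpleGraph V) (c : ℝ)
    (start len : Fin t → V → ℝ) : Prop :=
  0 < c ∧ (∀ i v, 0 ≤ len i v ∧ len i v < c) ∧
  ∀ u v : V, u ≠ v →
    (G.Adj u v ↔
      ∃ i j, (Arc c (start i u) (len i u) ∩ Arc c (start j v) (len j v)).Nonempty)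

/-- Two reals have the same image in `ℝ/cℤ` iff they differ by a multiple of `c`. -/
lemma coe_circle_eq_iff (c x y : ℝ) :
    ((y : ℝ) : AddCircle c) = (x : AddCircle c) ↔ ∃ k : ℤ, y = x + k * c := by
  rw [← sub_eq_zero, ← AddCircle.coe_sub, AddCircle.coe_eq_zero_iff]
  constructor
  · rintro ⟨k, hk⟩
    exact ⟨k, by rw [zsmul_eq_mul] at hk; linarith⟩
  · rintro ⟨k, hk⟩
    exact ⟨k, by rw [zsmul_eq_mul]; linarith⟩

/-- Intersection criterion for two arcs of equal length with starts in `[0, c)`. -/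
lemma arc_inter_iff (c p q d : ℝ) (hd : 0 ≤ d) (hdc : d < c) (hp : 0 ≤ p) (hpc : p < c)
    (hq : 0 ≤ q) (hqc : q < c) :
    (Arc c p d ∩ Arc c q d).Nonempty ↔
      ((p - q ≤ d ∧ q - p ≤ d) ∨ c - d ≤ p - q ∨ c - d ≤ q - p) := by
  have hc : 0 < c := lt_of_le_of_lt hd hdc
  constructor
  · rintro ⟨_, ⟨x, ⟨hx1, hx2⟩, rfl⟩, ⟨y, ⟨hy1, hy2⟩, hxy⟩⟩
    obtain ⟨k, rfl⟩ := (coe_circle_eq_iff c x y).1 hxy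
    have h1 : k < 2 := by
      by_contra h
      have h2 : (2 : ℝ) ≤ k := by exact_mod_cast not_lt.1 h
      nlinarith
    have h2 : -2 < k := by
      by_contra h
      have h2 : (k : ℝ) ≤ -2 := by exact_mod_cast not_lt.1 h
      nlinarith
    have h3 : k = -1 ∨ k = 0 ∨ k = 1 := by omega
    rcases h3 with rfl | rfl | rfl
    · right; left; push_cast at *; linarith
    · left; push_cast at *; constructor <;> linarith
    · right; right; push_cast at *; linarith
  · intro h
    have key : ∀ x y : ℝ, (∃ k : ℤ, y = x + k * c) → x ∈ Set.Icc p (p + d) →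
        y ∈ Set.Icc q (q + d) → (Arc c p d ∩ Arc c q d).Nonempty := by
      intro x y hk hx hy
      exact ⟨(x : AddCircle c), ⟨x, hx, rfl⟩, ⟨y, hy, (coe_circle_eq_iff c x y).2 hk⟩⟩
    rcases h with ⟨h1, h2⟩ | h | h
    · exact key (max p q) (max p q) ⟨0, by simp⟩
        ⟨le_max_left _ _, max_le (by linarith) (by linarith)⟩
        ⟨le_max_right _ _, max_le (by linarith) (by linarith)⟩
    · exact key (q + c) q ⟨-1, by push_cast; ring⟩ ⟨by linarith, by linarith⟩
        ⟨by linarith, by linarith⟩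
    · exact key p (p + c) ⟨1, by push_cast; ring⟩ ⟨by linarith, by linarith⟩
        ⟨by linarith, by linarith⟩

/-- Integer version of the intersection criterion. -/
def Near (c d p q : ℤ) : Prop :=
  (p - q ≤ d ∧ q - p ≤ d) ∨ c - d ≤ p - q ∨ c - d ≤ q - p

lemma near_comm (c d p q : ℤ) : Near c d p q ↔ Near c d q p := by
  unfold Near; omega

/-- Start points of the two arcs of each vertex of the subdivision. -/
def pos {V E : Type*} (d : ℤ) (F : V → ℤ) (g : E → ℤ) (l r : E → V) :
    Fin 2 → (V ⊕ (E × Fin 2)) → ℤ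
  | 0, Sum.inl v => F v
  | 1, Sum.inl v => 2 * d + F v + 2
  | 0, Sum.inr (e, 0) => d + F (l e) + 1
  | 1, Sum.inr (e, 0) => 4 * d + F (r e) + g e + 4
  | 0, Sum.inr (e, 1) => 3 * d + F (r e) + g e + 3
  | 1, Sum.inr (e, 1) => 5 * d + F (r e) + g e + 5

lemma exists_labels (V E : Type*) [Finite V] [Finite E] :
    ∃ (K S : ℤ) (F : V → ℤ) (g : E → ℤ), 2 ≤ K ∧ 0 ≤ S ∧ (∀ v, 0 ≤ F v ∧ F v ≤ S) ∧
      (∀ u v, u = v ∨ F u + K ≤ F v ∨ F v + K ≤ F u) ∧ (∀ e, 0 ≤ g e ∧ g e < K) ∧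
      (∀ e e', e = e' ∨ g e < g e' ∨ g e' < g e) := by
  obtain ⟨n, ⟨φ⟩⟩ := Finite.exists_equiv_fin V
  obtain ⟨m, ⟨ψ⟩⟩ := Finite.exists_equiv_fin E
  refine ⟨m + 2, (m + 2) * n, fun v => (m + 2) * ((φ v : ℕ) : ℤ), fun e => ((ψ e : ℕ) : ℤ),
    by omega, by positivity, ?_, ?_, ?_, ?_⟩
  · intro v
    refine ⟨by positivity, ?_⟩
    have : ((φ v : ℕ) : ℤ) ≤ n := by exact_mod_cast (φ v).2.le
    dsimp only
    gcongr
  · intro u v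
    rcases lt_trichotomy (φ u) (φ v) with h | h | h
    · right; left
      have : ((φ u : ℕ) : ℤ) + 1 ≤ (φ v : ℕ) := by exact_mod_cast h
      dsimp only; nlinarith
    · exact Or.inl (φ.injective h)
    · right; right
      have : ((φ v : ℕ) : ℤ) + 1 ≤ (φ u : ℕ) := by exact_mod_cast h
      dsimp only; nlinarith
  · intro e
    have := (ψ e).2
    dsimp only; omega
  · intro e e'
    rcases lt_trichotomy (ψ e) (ψ e') with h | h | h
    · right; left; dsimp only; exact_mod_cast h
    · exact Or.inl (ψ.injective h)
    · right; right; dsimp only; exact_mod_cast h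

set_option maxHeartbeats 1000000 in
theorem subd2_compl_is_unit_two_circular_interval_graph {V : Type*} [Fintype V]
    (G : SimpleGraph V) (l r : G.edgeSet → V)
    (hlr : ∀ e : G.edgeSet, (e : Sym2 V) = s(l e, r e)) :
    ∃ (c : ℝ) (start len : Fin 2 → (V ⊕ (G.edgeSet × Fin 2)) → ℝ),
      IsTCircIntervalRep 2 (Subd 2 G l r)ᶜ c start len ∧ ∃ d, ∀ i v, len i v = d := by
  obtain ⟨K, S, F, g, hK, hS, hF, hF', hg, hg'⟩ := exists_labels V G.edgeSet
  obtain ⟨d, hd⟩ : ∃ d : ℤ, d = 2 * S + 2 * K + 20 := ⟨_, rfl⟩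
  obtain ⟨c, hc⟩ : ∃ c : ℤ, c = 6 * d + K + 5 := ⟨_, rfl⟩
  have hpos : ∀ i v, 0 ≤ pos d F g l r i v ∧ pos d F g l r i v < c := by
    intro i v
    rcases v with v | ⟨e, j⟩
    · have := hF v
      fin_cases i <;> simp only [pos, Fin.zero_eta, Fin.mk_one] <;> omega
    · have := hF (l e)
      have := hF (r e)
      have := hg e
      fin_cases i <;> fin_cases j <;> simp only [pos, Fin.zero_eta, Fin.mk_one] <;> omega
  have hVV : ∀ u v : V, u ≠ v → ∃ i j, Near c d (pos d F g l r i (Sum.inl u))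
      (pos d F g l r j (Sum.inl v)) := by
    intro u v _
    refine ⟨0, 0, ?_⟩
    have := hF u
    have := hF v
    simp only [pos, Near]; omega
  have hEE : ∀ (e e' : G.edgeSet) (k : Fin 2), ∃ i j,
      Near c d (pos d F g l r i (Sum.inr (e, k))) (pos d F g l r j (Sum.inr (e', k))) := by
    intro e e' k
    refine ⟨0, 0, ?_⟩
    have := hF (l e)
    have := hF (l e')
    have := hF (r e)
    have := hF (r e')
    have := hg e
    have := hg e'
    fin_cases k <;> simp only [pos, Near, Fin.zero_eta, Fin.mk_one] <;> omega
  have hV0 : ∀ (v : V) (e : G.edgeSet), (∃ i j,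
      Near c d (pos d F g l r i (Sum.inl v)) (pos d F g l r j (Sum.inr (e, 0)))) ↔ v ≠ l e := by
    intro v e
    have := hF v
    have := hF (l e)
    have := hF (r e)
    have := hg e
    simp only [Fin.exists_fin_two, pos, Near]
    rcases eq_or_ne v (l e) with h | h
    · simp only [h, ne_eq, not_true_eq_false, iff_false]
      subst h
      omega
    · simp only [ne_eq, h, not_false_eq_true, iff_true]
      have := (hF' v (l e)).resolve_left h
      omega
  have hV1 : ∀ (v : V) (e : G.edgeSet), (∃ i j,
      Near c d (pos d F g l r i (Sum.inl v)) (pos d F g l r j (Sum.inr (e, 1)))) ↔ v ≠ r e := by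
    intro v e
    have := hF v
    have := hF (r e)
    have := hg e
    simp only [Fin.exists_fin_two, pos, Near]
    rcases eq_or_ne v (r e) with h | h
    · simp only [h, ne_eq, not_true_eq_false, iff_false]
      subst h
      omega
    · simp only [ne_eq, h, not_false_eq_true, iff_true]
      have := (hF' v (r e)).resolve_left h
      omega
  have h01 : ∀ (e e' : G.edgeSet), (∃ i j,
      Near c d (pos d F g l r i (Sum.inr (e, 0))) (pos d F g l r j (Sum.inr (e', 1)))) ↔
        e ≠ e' := by
    intro e e'
    have := hF (l e)
    have := hF (r e)
    have := hF (r e')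
    have := hg e
    have := hg e'
    simp only [Fin.exists_fin_two, pos, Near]
    rcases eq_or_ne e e' with h | h
    · subst h
      simp only [ne_eq, not_true_eq_false, iff_false]
      omega
    · simp only [ne_eq, h, not_false_eq_true, iff_true]
      have h1 := (hg' e e').resolve_left h
      rcases hF' (r e) (r e') with h2 | h2
      · rw [← h2] at *
        omega
      · omega
  have hswap : ∀ u v : V ⊕ (G.edgeSet × Fin 2),
      (∃ i j, Near c d (pos d F g l r i u) (pos d F g l r j v)) ↔
      (∃ i j, Near c d (pos d F g l r i v) (pos d F g l r j u)) := by
    intro u v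
    constructor
    · rintro ⟨i, j, h⟩
      exact ⟨j, i, (near_comm _ _ _ _).1 h⟩
    · rintro ⟨i, j, h⟩
      exact ⟨j, i, (near_comm _ _ _ _).1 h⟩
  have hd0 : (0 : ℝ) ≤ (d : ℝ) := by exact_mod_cast (by omega : 0 ≤ d)
  have hdc : (d : ℝ) < (c : ℝ) := by exact_mod_cast (by omega : d < c)
  refine ⟨c, fun i v => pos d F g l r i v, fun _ _ => d,
    ⟨lt_of_le_of_lt hd0 hdc, fun _ _ => ⟨hd0, hdc⟩, ?_⟩, d, fun _ _ => rfl⟩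
  intro u v huv
  have hnear : ∀ i j, (Arc (c : ℝ) (pos d F g l r i u : ℝ) d ∩
      Arc (c : ℝ) (pos d F g l r j v : ℝ) d).Nonempty ↔
      Near c d (pos d F g l r i u) (pos d F g l r j v) := by
    intro i j
    rw [arc_inter_iff _ _ _ _ hd0 hdc (by exact_mod_cast (hpos i u).1)
      (by exact_mod_cast (hpos i u).2) (by exact_mod_cast (hpos j v).1)
      (by exact_mod_cast (hpos j v).2)]
    unfold Near
    norm_cast
  simp only [hnear]
  rcases u with u | ⟨e, k⟩ <;> rcases v with v | ⟨e', k'⟩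
  · have huv' : u ≠ v := fun h => huv (by rw [h])
    simp [-Fin.exists_fin_two, Subd, huv', hVV u v huv']
  · fin_cases k'
    · simp [-Fin.exists_fin_two, Subd, hV0]
    · simp [-Fin.exists_fin_two, Subd, hV1]
  · rw [hswap]
    fin_cases k
    · simp [-Fin.exists_fin_two, Subd, hV0]
    · simp [-Fin.exists_fin_two, Subd, hV1]
  · fin_cases k <;> fin_cases k'
    · have := hEE e e' 0
      simp at huv
      simp [-Fin.exists_fin_two, Subd, this, huv]
    · simp [-Fin.exists_fin_two, Subd, h01]
    · rw [hswap]
      simp [-Fin.exists_fin_two, Subd, h01, eq_comm (a := e) (b := e')]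
    · have := hEE e e' 1
      simp at huv
      simp [-Fin.exists_fin_two, Subd, this, huv]
end

section
/- For any finite simple graph G, the complement of the 2-subdivision Subd_2(G) is a 2-circular track graph; that is, there exist two circles ℝ/c_1ℤ, ℝ/c_2ℤ and a 2-circular track representation of the complement of Subd_2(G) on them. -/
/-- A `t`-circular track representation of `G` on circles `ℝ/c i ℤ`: each vertex gets exactly
one arc (of length `< c i`) on each circle, and two distinct vertices are adjacent iff their
arcs intersect on some circle. -/
def IsTCircTrackRep {V : Type*} (t : ℕ) (G : SimpleGraph V) (c : Fin t → ℝ)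
    (start len : Fin t → V → ℝ) : Prop :=
  (∀ i, 0 < c i) ∧ (∀ i v, 0 ≤ len i v ∧ len i v < c i) ∧
  ∀ u v : V, u ≠ v →
    (G.Adj u v ↔
      ∃ i, (Arc (c i) (start i u) (len i u) ∩ Arc (c i) (start i v) (len i v)).Nonempty)

lemma arc_inter_symm (c p d q e : ℝ) :
    (Arc c p d ∩ Arc c q e).Nonempty ↔ (Arc c q e ∩ Arc c p d).Nonempty := by
  rw [Set.inter_comm]

lemma arc_meet (c p d q e : ℝ) (hd : 0 ≤ d) (he : 0 ≤ e) (h1 : p ≤ q + e) (h2 : q ≤ p + d) :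
    (Arc c p d ∩ Arc c q e).Nonempty := by
  refine ⟨((max p q : ℝ) : AddCircle c), ⟨max p q, ⟨le_max_left _ _, ?_⟩, rfl⟩,
    ⟨max p q, ⟨le_max_right _ _, ?_⟩, rfl⟩⟩
  · exact max_le (by linarith) h2
  · exact max_le h1 (by linarith)

lemma arc_shift (c q e : ℝ) : Arc c (q + c) e = Arc c q e := by
  ext x
  constructor
  · rintro ⟨y, ⟨h1, h2⟩, rfl⟩
    exact ⟨y - c, ⟨by linarith, by linarith⟩, by simp⟩
  · rintro ⟨y, ⟨h1, h2⟩, rfl⟩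
    exact ⟨y + c, ⟨by linarith, by linarith⟩, by simp⟩

lemma arc_meet_shift (c p d q e : ℝ) (hd : 0 ≤ d) (he : 0 ≤ e) (h1 : p ≤ q + c + e)
    (h2 : q + c ≤ p + d) : (Arc c p d ∩ Arc c q e).Nonempty := by
  rw [← arc_shift c q e]
  exact arc_meet c p d (q + c) e hd he h1 h2

lemma arc_disj (c p d q e : ℝ) (hc : 0 < c) (h1 : p + d < q) (h2 : q + e < p + c) :
    ¬ (Arc c p d ∩ Arc c q e).Nonempty := by
  rintro ⟨x, ⟨y, ⟨hy1, hy2⟩, rfl⟩, ⟨z, ⟨hz1, hz2⟩, hz⟩⟩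
  have hz' : ((z : ℝ) : AddCircle c) = (y : AddCircle c) := hz
  haveI : Fact (0 < c) := ⟨hc⟩
  rw [AddCircle.coe_eq_coe_iff_of_mem_Ico (p := c) (a := p)] at hz'
  · linarith
  · exact ⟨by linarith, by linarith⟩
  · exact ⟨by linarith, by linarith⟩

lemma exists_pos (V : Type*) [Finite V] :
    ∃ (n : ℝ) (x : V → ℝ), 0 ≤ n ∧ (∀ v, 0 ≤ x v ∧ x v ≤ n) ∧
      ∀ u v, u ≠ v → x u + 1 ≤ x v ∨ x v + 1 ≤ x u := by
  obtain ⟨n, ⟨f⟩⟩ := Finite.exists_equiv_fin V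
  refine ⟨n, fun v => ((f v : ℕ) : ℝ), by positivity, fun v => ⟨by positivity, ?_⟩, ?_⟩
  · show ((f v : ℕ) : ℝ) ≤ n
    exact_mod_cast (f v).2.le
  · intro u v h
    have : (f u : ℕ) ≠ f v := fun h' => h (f.injective (Fin.ext h'))
    rcases lt_or_gt_of_ne this with h | h
    · left
      show ((f u : ℕ) : ℝ) + 1 ≤ ((f v : ℕ) : ℝ)
      exact_mod_cast Nat.succ_le_of_lt h
    · right
      show ((f v : ℕ) : ℝ) + 1 ≤ ((f u : ℕ) : ℝ)
      exact_mod_cast Nat.succ_le_of_lt h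

lemma exists_shift (E : Type*) [Finite E] :
    ∃ (δ : ℝ) (s : E → ℝ), 0 < δ ∧ δ ≤ 1 / 8 ∧ (∀ e, 0 ≤ s e ∧ s e ≤ 1 / 8) ∧
      ∀ e f, e ≠ f → s e + δ ≤ s f ∨ s f + δ ≤ s e := by
  obtain ⟨n, x, hn, hx, hs⟩ := exists_pos E
  have hk : 0 < 1 / (8 * (n + 1)) := by positivity
  have hk1 : (1 / (8 * (n + 1))) * (n + 1) = 1 / 8 := by field_simp
  set k := 1 / (8 * (n + 1))
  refine ⟨k, fun e => k * x e, hk, by nlinarith, fun e => ⟨?_, ?_⟩, ?_⟩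
  · exact mul_nonneg hk.le (hx e).1
  · nlinarith [hx e]
  · intro e f h
    rcases hs e f h with h | h
    · left; nlinarith
    · right; nlinarith

/-- For any finite simple graph `G`, the complement of `Subd₂(G)` is a 2-circular track
graph. -/
theorem subd2_compl_is_two_circular_track_graph {V : Type*} [Fintype V]
    (G : SimpleGraph V) (l r : G.edgeSet → V)
    (hlr : ∀ e : G.edgeSet, (e : Sym2 V) = s(l e, r e)) :
    ∃ (c : Fin 2 → ℝ) (start len : Fin 2 → (V ⊕ (G.edgeSet × Fin 2)) → ℝ),
      IsTCircTrackRep 2 (Subd 2 G l r)ᶜ c start len := by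
  classical
  obtain ⟨n, x, hn, hx, hs⟩ := exists_pos V
  obtain ⟨δ, s, hδ, hδ', hsr, hss⟩ := exists_shift G.edgeSet
  have hne : ∀ e, l e ≠ r e := by
    intro e
    have h := e.2
    rw [hlr e, SimpleGraph.mem_edgeSet] at h
    exact h.ne
  have hinj : ∀ e f, l e = l f → r e = r f → e = f := by
    intro e f h1 h2
    apply Subtype.ext
    rw [hlr e, hlr f, h1, h2]
  let c : ℝ := 10 * (n + 1)
  have hc : c = 10 * (n + 1) := rfl
  -- circle 0
  let st0 : (V ⊕ (G.edgeSet × Fin 2)) → ℝ := fun u => match u with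
    | Sum.inl v => x v
    | Sum.inr (e, i) => if i = 0 then x (l e) + 1 / 4 + s e + δ / 2 else x (l e) - 1 / 4 + s e
  let ln0 : (V ⊕ (G.edgeSet × Fin 2)) → ℝ := fun u => match u with
    | Sum.inl v => 0
    | Sum.inr (e, i) => if i = 0 then c - 1 / 2 - δ else 1 / 2
  let st1 : (V ⊕ (G.edgeSet × Fin 2)) → ℝ := fun u => match u with
    | Sum.inl v => x v
    | Sum.inr (e, i) => if i = 0 then
        (if x (l e) < x (r e) then x (r e) + n + 1 / 4 else x (r e) - 1 / 4)
        else x (r e) + n + 1 / 2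
  let ln1 : (V ⊕ (G.edgeSet × Fin 2)) → ℝ := fun u => match u with
    | Sum.inl v => n
    | Sum.inr (e, i) => if i = 0 then 0 else c - n - 1
  have key : ∀ u v : V ⊕ (G.edgeSet × Fin 2), u ≠ v → 
      ((∃ i, (Arc c (![st0, st1] i u) (![ln0, ln1] i u) ∩
        Arc c (![st0, st1] i v) (![ln0, ln1] i v)).Nonempty) ↔
      ((Arc c (st0 u) (ln0 u) ∩ Arc c (st0 v) (ln0 v)).Nonempty ∨
       (Arc c (st1 u) (ln1 u) ∩ Arc c (st1 v) (ln1 v)).Nonempty)) := by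
    intro u v _
    rw [Fin.exists_fin_two]
    rfl
  refine ⟨fun _ => c, ![st0, st1], ![ln0, ln1], fun _ => by linarith, ?_, ?_⟩
  · intro i v
    fin_cases i
    · rcases v with v | ⟨e, j⟩
      · exact ⟨le_refl _, by show (0 : ℝ) < c; linarith⟩
      · fin_cases j
        · show 0 ≤ c - 1 / 2 - δ ∧ c - 1 / 2 - δ < c
          constructor <;> linarith
        · show (0 : ℝ) ≤ 1 / 2 ∧ 1 / 2 < c
          constructor <;> linarith
    · rcases v with v | ⟨e, j⟩
      · show 0 ≤ n ∧ n < c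
        constructor <;> linarith
      · fin_cases j
        · show (0 : ℝ) ≤ 0 ∧ 0 < c
          constructor <;> linarith
        · show 0 ≤ c - n - 1 ∧ c - n - 1 < c
          constructor <;> linarith
  have hc0 : 0 < c := by linarith
  -- the six kinds of pairs
  have VV : ∀ u v : V, (Arc c (x u) n ∩ Arc c (x v) n).Nonempty := by
    intro u v
    have := hx u
    have := hx v
    apply arc_meet <;> linarith
  have VA : ∀ (v : V) (e : G.edgeSet), (¬ v = l e) ↔
      ((Arc c (x v) 0 ∩ Arc c (x (l e) + 1 / 4 + s e + δ / 2) (c - 1 / 2 - δ)).Nonempty ∨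
       (Arc c (x v) n ∩ Arc c (if x (l e) < x (r e) then x (r e) + n + 1 / 4
          else x (r e) - 1 / 4) 0).Nonempty) := by
    intro v e
    have h1 := hx v
    have h2 := hx (l e)
    have h3 := hx (r e)
    have h4 := hsr e
    constructor
    · intro h
      left
      rw [arc_inter_symm]
      rcases hs _ _ h with h | h
      · apply arc_meet_shift <;> linarith
      · apply arc_meet <;> linarith
    · rintro h rfl
      rcases h with h | h
      · revert h
        apply arc_disj <;> linarith
      · revert h
        rcases hs _ _ (hne e) with h | h
        · rw [if_pos (by linarith)]
          apply arc_disj <;> linarith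
        · rw [if_neg (by linarith), arc_inter_symm]
          apply arc_disj <;> linarith
  have VB : ∀ (v : V) (e : G.edgeSet), (¬ v = r e) ↔
      ((Arc c (x v) 0 ∩ Arc c (x (l e) - 1 / 4 + s e) (1 / 2)).Nonempty ∨
       (Arc c (x v) n ∩ Arc c (x (r e) + n + 1 / 2) (c - n - 1)).Nonempty) := by
    intro v e
    have h1 := hx v
    have h2 := hx (l e)
    have h3 := hx (r e)
    have h4 := hsr e
    constructor
    · intro h
      right
      rw [arc_inter_symm]
      rcases hs _ _ h with h | h
      · apply arc_meet_shift <;> linarith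
      · apply arc_meet <;> linarith
    · rintro h rfl
      rcases h with h | h
      · revert h
        rcases hs _ _ (hne e) with h | h
        · rw [arc_inter_symm]
          apply arc_disj <;> linarith
        · apply arc_disj <;> linarith
      · revert h
        apply arc_disj <;> linarith
  have AA : ∀ e f : G.edgeSet, (Arc c (x (l e) + 1 / 4 + s e + δ / 2) (c - 1 / 2 - δ) ∩
      Arc c (x (l f) + 1 / 4 + s f + δ / 2) (c - 1 / 2 - δ)).Nonempty := by
    intro e f
    have h2 := hx (l e)
    have h3 := hx (l f)
    have h4 := hsr e
    have h5 := hsr f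
    apply arc_meet <;> linarith
  have BB : ∀ e f : G.edgeSet, (Arc c (x (r e) + n + 1 / 2) (c - n - 1) ∩
      Arc c (x (r f) + n + 1 / 2) (c - n - 1)).Nonempty := by
    intro e f
    have h2 := hx (r e)
    have h3 := hx (r f)
    apply arc_meet <;> linarith
  have AB : ∀ e f : G.edgeSet, (¬ e = f) ↔
      ((Arc c (x (l e) + 1 / 4 + s e + δ / 2) (c - 1 / 2 - δ) ∩
        Arc c (x (l f) - 1 / 4 + s f) (1 / 2)).Nonempty ∨
       (Arc c (if x (l e) < x (r e) then x (r e) + n + 1 / 4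
          else x (r e) - 1 / 4) 0 ∩ Arc c (x (r f) + n + 1 / 2) (c - n - 1)).Nonempty) := by
    intro e f
    have h2 := hx (l e)
    have h3 := hx (l f)
    have h4 := hsr e
    have h5 := hsr f
    constructor
    · intro h
      left
      by_cases hl : l e = l f
      · rw [← hl]
        rcases hss _ _ h with h | h
        · apply arc_meet <;> linarith
        · apply arc_meet_shift <;> linarith
      · rcases hs _ _ hl with h | h
        · apply arc_meet <;> linarith
        · apply arc_meet_shift <;> linarith
    · rintro h rfl
      rcases h with h | h
      · revert h
        rw [arc_inter_symm]
        apply arc_disj <;> linarith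
      · revert h
        split_ifs
        · apply arc_disj <;> linarith
        · apply arc_disj <;> linarith
  have symm : ∀ u v : V ⊕ (G.edgeSet × Fin 2),
      (u ≠ v → ((Subd 2 G l r)ᶜ.Adj u v ↔
      ((Arc c (st0 u) (ln0 u) ∩ Arc c (st0 v) (ln0 v)).Nonempty ∨
       (Arc c (st1 u) (ln1 u) ∩ Arc c (st1 v) (ln1 v)).Nonempty))) →
      (v ≠ u → ((Subd 2 G l r)ᶜ.Adj v u ↔
      ((Arc c (st0 v) (ln0 v) ∩ Arc c (st0 u) (ln0 u)).Nonempty ∨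
       (Arc c (st1 v) (ln1 v) ∩ Arc c (st1 u) (ln1 u)).Nonempty))) := by
    intro u v h h'
    rw [SimpleGraph.adj_comm, h h'.symm, arc_inter_symm, arc_inter_symm c (st1 u)]
  have fVE : ∀ (v : V) (e : G.edgeSet) (i : Fin 2),
      (Sum.inl v : V ⊕ (G.edgeSet × Fin 2)) ≠ Sum.inr (e, i) →
      ((Subd 2 G l r)ᶜ.Adj (Sum.inl v) (Sum.inr (e, i)) ↔
      ((Arc c (st0 (Sum.inl v)) (ln0 (Sum.inl v)) ∩
          Arc c (st0 (Sum.inr (e, i))) (ln0 (Sum.inr (e, i)))).Nonempty ∨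
       (Arc c (st1 (Sum.inl v)) (ln1 (Sum.inl v)) ∩
          Arc c (st1 (Sum.inr (e, i))) (ln1 (Sum.inr (e, i)))).Nonempty)) := by
    intro v e i _
    fin_cases i
    · refine Iff.trans ?_ (VA v e)
      simp [Subd]
    · refine Iff.trans ?_ (VB v e)
      simp [Subd]
  have fAB : ∀ (e f : G.edgeSet),
      (Sum.inr (e, 0) : V ⊕ (G.edgeSet × Fin 2)) ≠ Sum.inr (f, 1) →
      ((Subd 2 G l r)ᶜ.Adj (Sum.inr (e, 0)) (Sum.inr (f, 1)) ↔
      ((Arc c (st0 (Sum.inr (e, 0))) (ln0 (Sum.inr (e, 0))) ∩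
          Arc c (st0 (Sum.inr (f, 1))) (ln0 (Sum.inr (f, 1)))).Nonempty ∨
       (Arc c (st1 (Sum.inr (e, 0))) (ln1 (Sum.inr (e, 0))) ∩
          Arc c (st1 (Sum.inr (f, 1))) (ln1 (Sum.inr (f, 1)))).Nonempty)) := by
    intro e f _
    refine Iff.trans ?_ (AB e f)
    simp [Subd]
  intro u v huv
  refine Iff.trans ?_ (key u v huv).symm
  rcases u with u | ⟨e, i⟩ <;> rcases v with v | ⟨f, j⟩
  · refine iff_of_true ?_ (Or.inr (VV u v))
    simpa [Subd] using huv
  · exact fVE u f j huv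
  · exact symm _ _ (fVE v e i) huv
  · fin_cases i <;> fin_cases j
    · refine iff_of_true ?_ (Or.inl (AA e f))
      simpa [Subd] using huv
    · exact fAB e f huv
    · exact symm _ _ (fAB f e) huv
    · refine iff_of_true ?_ (Or.inr (BB e f))
      simpa [Subd] using huv
end

section
/- Let t ≥ 1 and let I_1,…,I_t : V → {closed bounded intervals of ℝ} be a balanced t-interval representation of a clique on a finite nonempty vertex set V, i.e., for each v ∈ V all intervals I_1(v),…,I_t(v) have a common length ℓ(v), and for every two distinct u,v ∈ V the sets ⋃_i I_i(u) and ⋃_j I_j(v) intersect. Let u ∈ V be a vertex minimizing ℓ. Then the set T consisting of the 2t endpoints of the intervals I_1(u),…,I_t(u) is a transversal: for every v ∈ V there is some i ∈ {1,…,t} such that I_i(v) contains a point of T. -/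
/-- In any balanced `t`-interval representation of a clique, the `2t` endpoints of the
intervals of a vertex `u` with the smallest interval length form a transversal. -/
theorem balanced_clique_endpoints_transversal {V : Type*} [Fintype V] [Nonempty V]
    (t : ℕ) (ht : 1 ≤ t) (lo hi : Fin t → V → ℝ)
    (hle : ∀ i v, lo i v ≤ hi i v)
    (ℓ : V → ℝ) (hbal : ∀ i v, hi i v - lo i v = ℓ v)
    (hclique : ∀ u v : V, u ≠ v →
      ((⋃ i, Set.Icc (lo i u) (hi i u)) ∩ ⋃ j, Set.Icc (lo j v) (hi j v)).Nonempty)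
    (u : V) (hmin : ∀ v, ℓ u ≤ ℓ v) :
    ∀ v : V, ∃ i j : Fin t,
      lo j u ∈ Set.Icc (lo i v) (hi i v) ∨ hi j u ∈ Set.Icc (lo i v) (hi i v) := by
  intro v
  by_cases huv : u = v
  · subst huv
    exact ⟨⟨0, ht⟩, ⟨0, ht⟩, Or.inl ⟨le_refl _, hle _ _⟩⟩
  · obtain ⟨x, hx1, hx2⟩ := hclique u v huv
    obtain ⟨j, hj1, hj2⟩ := Set.mem_iUnion.mp hx1
    obtain ⟨i, hi1, hi2⟩ := Set.mem_iUnion.mp hx2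
    refine ⟨i, j, ?_⟩
    have h1 := hbal j u
    have h2 := hbal i v
    have h3 := hmin v
    by_cases h : lo i v ≤ lo j u
    · exact Or.inl ⟨h, by linarith⟩
    · exact Or.inr ⟨by linarith, by linarith⟩
end

section
/- Let t ≥ 1, let G = (V,E) be a finite simple graph with a t-interval representation I_1,…,I_t, and let w : V → ℝ_{≥0} be vertex weights. Then for every nonempty clique K ⊆ V there exists a point p ∈ ℝ such that Σ_{v ∈ K, p ∈ ⋃_i I_i(v)} w(v) ≥ (Σ_{v ∈ K} w(v)) / (2t). -/
open scoped Classical in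
/-- Given a `t`-interval representation of a weighted graph, for every nonempty clique `K`
there is a point of the line covering at least a `1/(2t)` fraction of the weight of `K`. -/
theorem exists_point_covering_weight_div_two_t {V : Type*} [Fintype V]
    (t : ℕ) (ht : 1 ≤ t) (G : SimpleGraph V) (lo hi : Fin t → V → ℝ)
    (hrep : IsTIntervalRep t G lo hi) (w : V → NNReal)
    (K : Finset V) (hK : K.Nonempty) (hKclique : G.IsClique (K : Set V)) :
    ∃ p : ℝ,
      (∑ v ∈ K, w v) / (2 * t) ≤
        ∑ v ∈ K.filter (fun v => p ∈ ⋃ i, Set.Icc (lo i v) (hi i v)), w v := by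
  obtain ⟨hle, hadj⟩ := hrep
  set U : V → Set ℝ := fun v => ⋃ i, Set.Icc (lo i v) (hi i v) with hU
  set c : ℝ → NNReal := fun p => ∑ v ∈ K.filter (fun v => p ∈ U v), w v with hc
  set W : NNReal := ∑ v ∈ K, w v with hW
  change ∃ p : ℝ, W / (2 * t) ≤ c p
  let i0 : Fin t := ⟨0, ht⟩
  obtain ⟨k0, hk0⟩ := hK
  obtain ⟨⟨m, j⟩, -, hm⟩ := Finset.exists_max_image (K ×ˢ (Finset.univ : Finset (Fin t)))
    (fun x => c (lo x.2 x.1)) ⟨(k0, i0), by simp [hk0]⟩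
  refine ⟨lo j m, ?_⟩
  set M := c (lo j m) with hM
  have hmax : ∀ u ∈ K, ∀ i, c (lo i u) ≤ M := fun u hu i => hm (u, i) (by simp [hu])
  let f : V → V → NNReal := fun u v => ∑ i, if lo i u ∈ U v then 1 else 0
  have hf1 : ∀ u v i, lo i u ∈ U v → 1 ≤ f u v := by
    intro u v i h
    have := Finset.single_le_sum (f := fun i => if lo i u ∈ U v then (1 : NNReal) else 0)
      (fun _ _ => zero_le) (Finset.mem_univ i)
    rwa [if_pos h] at this
  have hself : ∀ u i, lo i u ∈ U u := fun u i =>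
    Set.mem_iUnion.2 ⟨i, le_rfl, hle i u⟩
  have hpair : ∀ u ∈ K, ∀ v ∈ K, 1 ≤ f u v + f v u := by
    intro u hu v hv
    by_cases huv : u = v
    · subst huv
      exact (hf1 u u i0 (hself u i0)).trans le_self_add
    · obtain ⟨x, hx1, hx2⟩ := (hadj u v huv).1 (hKclique hu hv huv)
      obtain ⟨i, hi1, hi2⟩ := Set.mem_iUnion.1 hx1
      obtain ⟨k, hk1, hk2⟩ := Set.mem_iUnion.1 hx2
      rcases le_total (lo i u) (lo k v) with h | h
      · exact (hf1 v u k (Set.mem_iUnion.2 ⟨i, h, hk1.trans hi2⟩)).trans le_add_self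
      · exact (hf1 u v i (Set.mem_iUnion.2 ⟨k, h, hi1.trans hk2⟩)).trans le_self_add
  set S : NNReal := ∑ u ∈ K, ∑ v ∈ K, w u * w v * f u v with hS
  have hS' : S = ∑ u ∈ K, ∑ v ∈ K, w u * w v * f v u := by
    rw [hS, Finset.sum_comm]
    refine Finset.sum_congr rfl fun u _ => Finset.sum_congr rfl fun v _ => by ring
  have h1 : W * W ≤ S + S := by
    nth_rewrite 2 [hS']
    rw [hS, hW, Finset.sum_mul_sum, ← Finset.sum_add_distrib]
    refine Finset.sum_le_sum fun u hu => ?_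
    rw [← Finset.sum_add_distrib]
    refine Finset.sum_le_sum fun v hv => ?_
    rw [← mul_add]
    exact le_mul_of_one_le_right zero_le (hpair u hu v hv)
  have h2 : S ≤ W * (t * M) := by
    rw [hS, hW, Finset.sum_mul]
    refine Finset.sum_le_sum fun u hu => ?_
    have : ∑ v ∈ K, w u * w v * f u v = w u * ∑ i, c (lo i u) := by
      simp only [hc, f, Finset.sum_filter, Finset.mul_sum]
      rw [Finset.sum_comm]
      refine Finset.sum_congr rfl fun i _ => Finset.sum_congr rfl fun v _ => ?_
      split_ifs <;> simp
    rw [this]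
    gcongr
    calc ∑ i, c (lo i u) ≤ ∑ _i : Fin t, M := Finset.sum_le_sum fun i _ => hmax u hu i
      _ = t * M := by simp
  rcases eq_or_ne W 0 with h0 | h0
  · simp [h0]
  have h3 : W * W ≤ W * (M * (2 * t)) :=
    calc W * W ≤ S + S := h1
      _ ≤ W * (t * M) + W * (t * M) := add_le_add h2 h2
      _ = _ := by ring
  have h4 : W ≤ M * (2 * t) := le_of_mul_le_mul_left h3 (pos_iff_ne_zero.2 h0)
  have ht' : (0 : NNReal) < 2 * t := by
    have : (0 : NNReal) < t := by exact_mod_cast ht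
    positivity
  exact (div_le_iff₀ ht').2 h4
end

section
/- Let t ≥ 1, let G = (V,E) be a finite simple graph with a t-interval representation I_1,…,I_t, and let w : V → ℝ_{≥0} be vertex weights. Then for every nonempty clique K ⊆ V there exist two points p, q ∈ ℝ such that Σ_{v ∈ K, p ∈ ⋃_i I_i(v) or q ∈ ⋃_i I_i(v)} w(v) ≥ (Σ_{v ∈ K} w(v)) / t. -/
open scoped Classical in
/-- In a weighted reflexive semicomplete digraph some vertex is dominated by half the weight. -/
lemma exists_half_dominated {V : Type*} (K : Finset V) (hK : K.Nonempty) (w : V → ℝ)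
    (hw : ∀ v, 0 ≤ w v) (R : V → V → Prop) (hR : ∀ u ∈ K, ∀ v ∈ K, R u v ∨ R v u) :
    ∃ u ∈ K, ∑ v ∈ K, w v ≤ 2 * ∑ v ∈ K.filter (fun v => R u v), w v := by
  by_contra! hcon
  obtain ⟨u₀, hu₀⟩ := hK
  have hpos : 0 < ∑ v ∈ K, w v := by
    refine lt_of_le_of_lt ?_ (hcon u₀ hu₀)
    have := Finset.sum_nonneg (s := K.filter (fun v => R u₀ v)) (fun v _ => hw v)
    linarith
  obtain ⟨x, hx, hwx⟩ : ∃ x ∈ K, 0 < w x := by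
    by_contra! h
    exact absurd (Finset.sum_nonpos h) (not_le.mpr hpos)
  have hlt : ∑ u ∈ K, w u * (2 * ∑ v ∈ K.filter (fun v => R u v), w v)
      < ∑ u ∈ K, w u * ∑ v ∈ K, w v := by
    refine Finset.sum_lt_sum (fun u hu => ?_) ⟨x, hx, ?_⟩
    · exact mul_le_mul_of_nonneg_left (hcon u hu).le (hw u)
    · exact mul_lt_mul_of_pos_left (hcon x hx) hwx
  have h1 : ∑ u ∈ K, w u * (2 * ∑ v ∈ K.filter (fun v => R u v), w v)
      = ∑ u ∈ K, ∑ v ∈ K, (if R u v then w u * w v else 0)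
        + ∑ u ∈ K, ∑ v ∈ K, (if R v u then w u * w v else 0) := by
    have h2 : ∑ u ∈ K, ∑ v ∈ K, (if R v u then w u * w v else 0)
        = ∑ u ∈ K, ∑ v ∈ K, (if R u v then w u * w v else 0) := by
      rw [Finset.sum_comm]
      simp only [mul_comm]
    rw [h2, ← two_mul, Finset.mul_sum]
    refine Finset.sum_congr rfl fun u _ => ?_
    rw [Finset.sum_filter, mul_left_comm, Finset.mul_sum]
    simp only [mul_ite, mul_zero]
  rw [h1, ← Finset.sum_add_distrib] at hlt
  refine absurd hlt (not_lt.mpr ?_)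
  refine Finset.sum_le_sum fun u hu => ?_
  rw [← Finset.sum_add_distrib, Finset.mul_sum]
  refine Finset.sum_le_sum fun v hv => ?_
  have := mul_nonneg (hw u) (hw v)
  rcases hR u hu v hv with h | h
  · rw [if_pos h]; split_ifs <;> linarith
  · rw [if_pos h]; split_ifs <;> linarith

open scoped Classical in
/-- Given a `t`-interval representation of a weighted graph, for every nonempty clique `K`
there are two points of the line covering at least a `1/t` fraction of the weight of `K`. -/
theorem exists_two_points_covering_weight_div_t {V : Type*} [Fintype V]
    (t : ℕ) (ht : 1 ≤ t) (G : SimpleGraph V) (lo hi : Fin t → V → ℝ)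
    (hrep : IsTIntervalRep t G lo hi) (w : V → NNReal)
    (K : Finset V) (hK : K.Nonempty) (hKclique : G.IsClique (K : Set V)) :
    ∃ p q : ℝ,
      (∑ v ∈ K, w v) / t ≤
        ∑ v ∈ K.filter (fun v =>
          p ∈ (⋃ i, Set.Icc (lo i v) (hi i v)) ∨ q ∈ ⋃ i, Set.Icc (lo i v) (hi i v)), w v := by
  obtain ⟨hle, hadj⟩ := hrep
  -- any two members of the clique have intersecting intervals
  have hint : ∀ u ∈ K, ∀ v ∈ K, ∃ i j, lo i u ≤ hi j v ∧ lo j v ≤ hi i u := by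
    intro u hu v hv
    by_cases huv : u = v
    · subst huv
      exact ⟨⟨0, ht⟩, ⟨0, ht⟩, hle _ _, hle _ _⟩
    · obtain ⟨x, hx1, hx2⟩ := (hadj u v huv).1 (hKclique hu hv huv)
      obtain ⟨i, hi1⟩ := Set.mem_iUnion.1 hx1
      obtain ⟨j, hj1⟩ := Set.mem_iUnion.1 hx2
      exact ⟨i, j, hi1.1.trans hj1.2, hj1.1.trans hi1.2⟩
  obtain ⟨n, rfl⟩ : ∃ n, t = n + 1 := ⟨t - 1, by omega⟩
  rcases Nat.eq_zero_or_pos n with rfl | hn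
  · -- one interval per vertex: the rightmost left endpoint works
    obtain ⟨u, hu, hmax⟩ := K.exists_max_image (fun v => lo 0 v) hK
    refine ⟨lo 0 u, lo 0 u, ?_⟩
    rw [Finset.filter_true_of_mem]
    · simp
    · intro v hv
      left
      obtain ⟨i, j, h1, -⟩ := hint u hu v hv
      have hi0 : i = 0 := Fin.ext (by have := i.2; simp only [Fin.val_zero]; omega)
      have hj0 : j = 0 := Fin.ext (by have := j.2; simp only [Fin.val_zero]; omega)
      subst hi0 hj0
      exact Set.mem_iUnion.2 ⟨0, hmax v hv, h1⟩
  · obtain ⟨u, hu, hhalf⟩ := exists_half_dominated K hK (fun v => (w v : ℝ)) (fun v => (w v).2)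
      (fun u v => ∃ i, lo i u ∈ ⋃ j, Set.Icc (lo j v) (hi j v)) (by
        intro u hu v hv
        obtain ⟨i, j, h1, h2⟩ := hint u hu v hv
        rcases le_total (lo i u) (lo j v) with h | h
        · exact Or.inr ⟨j, Set.mem_iUnion.2 ⟨i, h, h2⟩⟩
        · exact Or.inl ⟨i, Set.mem_iUnion.2 ⟨j, h, h1⟩⟩)
    set S := K.filter (fun v => ∃ i, lo i u ∈ ⋃ j, Set.Icc (lo j v) (hi j v)) with hS
    have hhalf' : ∑ v ∈ K, (w v : ℝ) ≤ 2 * ∑ v ∈ S, (w v : ℝ) := by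
      convert hhalf
    have hf : ∀ v, ∃ i, v ∈ S → lo i u ∈ ⋃ j, Set.Icc (lo j v) (hi j v) := by
      intro v
      by_cases hv : v ∈ S
      · obtain ⟨i, h⟩ := (Finset.mem_filter.1 hv).2
        exact ⟨i, fun _ => h⟩
      · exact ⟨0, fun h => absurd h hv⟩
    choose f hf using hf
    let A : Fin (n + 1) → ℝ := fun i => ∑ v ∈ S.filter (fun v => f v = i), (w v : ℝ)
    have hA : ∑ i, A i = ∑ v ∈ S, (w v : ℝ) := Finset.sum_fiberwise S f _
    have hA' : ∑ i, A (i + 1) = ∑ v ∈ S, (w v : ℝ) := by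
      rw [← hA]
      exact Equiv.sum_comp (Equiv.addRight (1 : Fin (n + 1))) A
    obtain ⟨i, -, hi'⟩ : ∃ i ∈ (Finset.univ : Finset (Fin (n + 1))),
        (∑ v ∈ K, (w v : ℝ)) / ((n + 1 : ℕ) : ℝ) ≤ A i + A (i + 1) := by
      refine Finset.exists_le_of_sum_le Finset.univ_nonempty ?_
      rw [Finset.sum_add_distrib, hA, hA', Finset.sum_const, Finset.card_univ, Fintype.card_fin,
        nsmul_eq_mul, mul_div_cancel₀ _ (by positivity)]
      linarith
    have hne : i ≠ i + 1 := by
      intro h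
      have h1 : (1 : Fin (n + 1)) = 0 := by simpa using h.symm
      have h2 := congrArg Fin.val h1
      rw [Fin.val_one', Fin.val_zero, Nat.mod_eq_of_lt (by omega)] at h2
      omega
    refine ⟨lo i u, lo (i + 1) u, ?_⟩
    rw [← NNReal.coe_le_coe]
    push_cast
    push_cast at hi'
    refine hi'.trans ?_
    have hdisj : Disjoint (S.filter (fun v => f v = i)) (S.filter (fun v => f v = i + 1)) := by
      rw [Finset.disjoint_left]
      intro v hv hv'
      exact hne ((Finset.mem_filter.1 hv).2.symm.trans (Finset.mem_filter.1 hv').2)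
    change ∑ v ∈ S.filter (fun v => f v = i), (w v : ℝ)
      + ∑ v ∈ S.filter (fun v => f v = i + 1), (w v : ℝ) ≤ _
    rw [← Finset.sum_union hdisj]
    refine Finset.sum_le_sum_of_subset_of_nonneg ?_ (fun v _ _ => (w v).2)
    intro v hv
    rcases Finset.mem_union.1 hv with h | h
    · obtain ⟨h1, h2⟩ := Finset.mem_filter.1 h
      exact Finset.mem_filter.2 ⟨(Finset.mem_filter.1 h1).1, Or.inl (h2 ▸ hf v h1)⟩
    · obtain ⟨h1, h2⟩ := Finset.mem_filter.1 h
      exact Finset.mem_filter.2 ⟨(Finset.mem_filter.1 h1).1, Or.inr (h2 ▸ hf v h1)⟩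
end

section
/- Every finite simple graph G = (V,E) admitting a t-interval representation is t-perfectly orientable: there exist an orientation of the edges of G (a choice, for each edge uv ∈ E, of a direction u→v or v→u) and a coloring of the oriented edges with colors from {1,…,t} such that for every vertex u and every color i, the set of out-neighbors of u along edges colored i is a clique of G (i.e., the out-neighborhood of every vertex is the union of at most t cliques). -/
/-- Every graph with a `t`-interval representation is `t`-perfectly orientable: its edges can
be oriented (relation `D`) and the oriented edges colored with colors `< t` (function `col`)
so that for each vertex `u` and each color `i`, the out-neighbors of `u` along edges of color
`i` form a clique. -/
theorem t_interval_graph_is_t_perfectly_orientable {V : Type*} [Fintype V]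
    (t : ℕ) (G : SimpleGraph V) (lo hi : Fin t → V → ℝ)
    (hrep : IsTIntervalRep t G lo hi) :
    ∃ (D : V → V → Prop) (col : V → V → ℕ),
      (∀ u v, D u v → G.Adj u v) ∧
      (∀ u v, G.Adj u v → (D u v ↔ ¬ D v u)) ∧
      (∀ u v, D u v → col u v < t) ∧
      (∀ u : V, ∀ i : ℕ, G.IsClique {v | D u v ∧ col u v = i}) := by
  classical
  obtain ⟨-, hadj⟩ := hrep
  let e := Fintype.equivFin V
  let P : V → V → Fin t → Prop := fun u v i => ∃ j, lo i u ∈ Set.Icc (lo j v) (hi j v)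
  have hP : ∀ u v, G.Adj u v → (∃ i, P u v i) ∨ (∃ i, P v u i) := by
    intro u v h
    obtain ⟨x, hx1, hx2⟩ := (hadj u v h.ne).1 h
    obtain ⟨i, hi1, hi2⟩ := Set.mem_iUnion.1 hx1
    obtain ⟨j, hj1, hj2⟩ := Set.mem_iUnion.1 hx2
    rcases le_total (lo i u) (lo j v) with hl | hl
    · exact Or.inr ⟨j, i, hl, hj1.trans hi2⟩
    · exact Or.inl ⟨i, j, hl, hi1.trans hj2⟩
  refine ⟨fun u v => G.Adj u v ∧ (∃ i, P u v i) ∧ ((∃ i, P v u i) → e u < e v),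
    fun u v => if h : ∃ i, P u v i then (h.choose : ℕ) else 0, ?_, ?_, ?_, ?_⟩
  · intro u v h
    exact h.1
  · intro u v h
    have h1 := hP u v h
    have h2 := h.symm
    beta_reduce
    generalize (∃ i, P u v i) = A at *
    generalize (∃ i, P v u i) = B at *
    have h3 : e u ≠ e v := fun hh => h.ne (e.injective hh)
    rcases lt_or_gt_of_ne h3 with h4 | h4
    · have h5 := h4.not_gt
      tauto
    · have h5 := h4.not_gt
      tauto
  · rintro u v ⟨-, h, -⟩
    simp only [dif_pos h]
    exact h.choose.2
  · rintro u i v ⟨⟨-, hv, -⟩, cv⟩ w ⟨⟨-, hw, -⟩, cw⟩ hne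
    simp only [dif_pos hv] at cv
    simp only [dif_pos hw] at cw
    have heq : hv.choose = hw.choose := Fin.ext (cv.trans cw.symm)
    obtain ⟨j, hj⟩ := hv.choose_spec
    obtain ⟨k, hk⟩ := hw.choose_spec
    rw [← heq] at hk
    exact (hadj v w hne).2 ⟨_, Set.mem_iUnion.2 ⟨j, hj⟩, Set.mem_iUnion.2 ⟨k, hk⟩⟩
end

section
/- For all positive integers w and l, the complement of the graph Q(w,l) is a unit 2-interval graph; that is, there exists a 2-interval representation of the complement of Q(w,l) in which all intervals have the same length. -/
/-- The vertex set of the graph `Q(w,l)`: in order, the classes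
`X^o` (size `w(l+1)`), `X^e` (size `wl`), `A`, `B`, `C`, `D` (each of size `2wl`),
where the vertex of index `p : Fin _` in a class stands for the vertex with
(1-based) subscript `p+1` of that class. -/
def QV (w l : ℕ) : Type :=
  Fin (w * (l + 1)) ⊕ (Fin (w * l) ⊕ (Fin (2 * w * l) ⊕
    (Fin (2 * w * l) ⊕ (Fin (2 * w * l) ⊕ Fin (2 * w * l)))))

/-- The graph `Q(w,l)`, whose (1-based) edges are:
`x^o_i a_{2i-1}, x^o_i a_{2i}` for `1 ≤ i ≤ wl`;
`x^o_i b_{2(i-w)-2}, x^o_i b_{2(i-w)-1}` for `w+1 ≤ i ≤ w(l+1)`;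
`x^e_i a_{2i-2}, x^e_i a_{2i-1}, x^e_i b_{2i-1}, x^e_i b_{2i}` for `1 ≤ i ≤ wl`;
`a_i c_i, c_i d_i, d_i b_{i+1}` for `1 ≤ i ≤ 2wl-1`
(edges with out-of-range subscripts being omitted). -/
def QGraph (w l : ℕ) : SimpleGraph (QV w l) :=
  SimpleGraph.fromRel fun u v =>
    match u, v with
    | Sum.inl p, Sum.inr (Sum.inr (Sum.inl q)) => -- x^o_{p+1} a_{q+1}
        p.val + 1 ≤ w * l ∧ (q.val + 2 = 2 * (p.val + 1) ∨ q.val + 1 = 2 * (p.val + 1))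
    | Sum.inl p, Sum.inr (Sum.inr (Sum.inr (Sum.inl q))) => -- x^o_{p+1} b_{q+1}
        q.val + 2 * w + 3 = 2 * (p.val + 1) ∨ q.val + 2 * w + 2 = 2 * (p.val + 1)
    | Sum.inr (Sum.inl p), Sum.inr (Sum.inr (Sum.inl q)) => -- x^e_{p+1} a_{q+1}
        q.val + 3 = 2 * (p.val + 1) ∨ q.val + 2 = 2 * (p.val + 1)
    | Sum.inr (Sum.inl p), Sum.inr (Sum.inr (Sum.inr (Sum.inl q))) => -- x^e_{p+1} b_{q+1}
        q.val + 2 = 2 * (p.val + 1) ∨ q.val + 1 = 2 * (p.val + 1)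
    | Sum.inr (Sum.inr (Sum.inl p)),
        Sum.inr (Sum.inr (Sum.inr (Sum.inr (Sum.inl q)))) => -- a_{p+1} c_{q+1}
        p.val = q.val ∧ p.val + 2 ≤ 2 * w * l
    | Sum.inr (Sum.inr (Sum.inr (Sum.inr (Sum.inl p)))),
        Sum.inr (Sum.inr (Sum.inr (Sum.inr (Sum.inr q)))) => -- c_{p+1} d_{q+1}
        p.val = q.val ∧ p.val + 2 ≤ 2 * w * l
    | Sum.inr (Sum.inr (Sum.inr (Sum.inr (Sum.inr p)))),
        Sum.inr (Sum.inr (Sum.inr (Sum.inl q))) => -- d_{p+1} b_{q+1}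
        q.val = p.val + 1
    | _, _ => False

/-- Common length of the intervals. -/
def qK (w l : ℕ) : ℤ := 100 * ((w * l : ℕ) + w + 1)

/-- Left endpoint of the first interval of each vertex. -/
def qs1 (w l : ℕ) : QV w l → ℤ
  | Sum.inl p => 2 * qK w l - 4 * (p.val + 1)
  | Sum.inr (Sum.inl p) => 2 * qK w l - 4 * (p.val + 1) + 2
  | Sum.inr (Sum.inr (Sum.inl p)) => qK w l - 2 * (p.val + 1) - 3
  | Sum.inr (Sum.inr (Sum.inr (Sum.inl p))) => 3 * qK w l + 4 * w + 2 * (p.val + 1) - 1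
  | Sum.inr (Sum.inr (Sum.inr (Sum.inr (Sum.inl p)))) =>
      2 * qK w l - 2 * (p.val + 1) - (if p.val + 2 ≤ 2 * (w * l) then 1 else 3)
  | Sum.inr (Sum.inr (Sum.inr (Sum.inr (Sum.inr p)))) =>
      4 * qK w l + 4 * w + 2 * (p.val + 1) + 3

/-- Left endpoint of the second interval of each vertex. -/
def qs2 (w l : ℕ) : QV w l → ℤ
  | Sum.inl p => 4 * qK w l + 4 * (p.val + 1) - 2
  | Sum.inr (Sum.inl p) => 4 * qK w l + 4 * w + 4 * (p.val + 1)
  | Sum.inr (Sum.inr (Sum.inl p)) => 3 * qK w l - 2 * (p.val + 1) + 1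
  | Sum.inr (Sum.inr (Sum.inr (Sum.inl p))) => 5 * qK w l + 4 * w + 2 * (p.val + 1) + 3
  | Sum.inr (Sum.inr (Sum.inr (Sum.inr (Sum.inl p)))) =>
      5 * qK w l + 4 * w + 2 * (p.val + 1) + 4
  | Sum.inr (Sum.inr (Sum.inr (Sum.inr (Sum.inr p)))) => qK w l - 2 * (p.val + 1) - 2

/-- Closeness of two left endpoints. -/
def qclose (K a b : ℤ) : Prop := a ≤ b + K ∧ b ≤ a + K

lemma q_inter {V : Type} (K : ℤ) (hK : 0 ≤ K) (s1 s2 : V → ℤ) (u v : V) :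
    ((⋃ i : Fin 2, Set.Icc (((if i = 0 then s1 u else s2 u) : ℤ) : ℝ)
        ((((if i = 0 then s1 u else s2 u) : ℤ) : ℝ) + K)) ∩
      ⋃ j : Fin 2, Set.Icc (((if j = 0 then s1 v else s2 v) : ℤ) : ℝ)
        ((((if j = 0 then s1 v else s2 v) : ℤ) : ℝ) + K)).Nonempty ↔
    (qclose K (s1 u) (s1 v) ∨ qclose K (s1 u) (s2 v) ∨ qclose K (s2 u) (s1 v) ∨
      qclose K (s2 u) (s2 v)) := by
  have key : ∀ a b : ℤ, qclose K a b ↔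
      ∃ x : ℝ, ((a : ℝ) ≤ x ∧ x ≤ a + K) ∧ ((b : ℝ) ≤ x ∧ x ≤ b + K) := by
    intro a b
    constructor
    · rintro ⟨h1, h2⟩
      have h1' : (a : ℝ) ≤ b + K := by exact_mod_cast h1
      have h2' : (b : ℝ) ≤ a + K := by exact_mod_cast h2
      have hK' : (0 : ℝ) ≤ K := by exact_mod_cast hK
      refine ⟨max a b, ⟨le_max_left _ _, max_le (by linarith) h2'⟩,
        ⟨le_max_right _ _, max_le h1' (by linarith)⟩⟩
    · rintro ⟨x, ⟨h1, h2⟩, h3, h4⟩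
      have h5 : (a : ℝ) ≤ b + K := by linarith
      have h6 : (b : ℝ) ≤ a + K := by linarith
      exact ⟨by exact_mod_cast h5, by exact_mod_cast h6⟩
  simp only [key, Set.Nonempty, Set.mem_inter_iff, Set.mem_iUnion, Fin.exists_fin_two,
    Set.mem_Icc, ← exists_or]
  apply exists_congr
  intro x
  simp only [if_true, one_ne_zero, if_false]
  tauto

set_option maxHeartbeats 4000000 in
lemma q_main (w l : ℕ) (hw : 0 < w) (u v : QV w l) (huv : u ≠ v) :
    (QGraph w l)ᶜ.Adj u v ↔
    (qclose (qK w l) (qs1 w l u) (qs1 w l v) ∨ qclose (qK w l) (qs1 w l u) (qs2 w l v) ∨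
      qclose (qK w l) (qs2 w l u) (qs1 w l v) ∨ qclose (qK w l) (qs2 w l u) (qs2 w l v)) := by
  have e1 : w * (l + 1) = w * l + w := by ring
  have e2 : 2 * w * l = 2 * (w * l) := by ring
  rw [SimpleGraph.compl_adj, QGraph, SimpleGraph.fromRel_adj]
  simp only [ne_eq, huv, not_false_eq_true, true_and]
  clear huv
  rcases u with ⟨p, hp⟩ | ⟨p, hp⟩ | ⟨p, hp⟩ | ⟨p, hp⟩ | ⟨p, hp⟩ | ⟨p, hp⟩ <;>
  rcases v with ⟨q, hq⟩ | ⟨q, hq⟩ | ⟨q, hq⟩ | ⟨q, hq⟩ | ⟨q, hq⟩ | ⟨q, hq⟩ <;>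
  simp only [qclose, qs1, qs2, qK, e2, or_false, false_or, not_false_eq_true, true_iff, or_self] <;>
  (try rw [e1] at hp) <;> (try rw [e1] at hq) <;> (try rw [e2] at hp) <;> (try rw [e2] at hq) <;>
  clear e1 e2 <;>
  generalize w * l = m at * <;>
  (try split_ifs) <;> omega

/-- For all positive `w` and `l`, the complement of `Q(w,l)` is a unit 2-interval graph. -/
theorem Q_compl_is_unit_two_interval_graph (w l : ℕ) (hw : 0 < w) (hl : 0 < l) :
    ∃ lo hi : Fin 2 → QV w l → ℝ,
      IsTIntervalRep 2 (QGraph w l)ᶜ lo hi ∧ IsUnitRep 2 lo hi := by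
  have hK : 0 ≤ qK w l := by unfold qK; positivity
  refine ⟨fun i v => (((if i = 0 then qs1 w l v else qs2 w l v) : ℤ) : ℝ),
    fun i v => (((if i = 0 then qs1 w l v else qs2 w l v) : ℤ) : ℝ) + (qK w l : ℤ),
    ⟨?_, ?_⟩, ⟨(qK w l : ℤ), ?_⟩⟩
  · intro i v
    have : (0 : ℝ) ≤ (qK w l : ℤ) := by exact_mod_cast hK
    simpa using this
  · intro u v huv
    rw [q_main w l hw u v huv]
    exact (q_inter (qK w l) hK (qs1 w l) (qs2 w l) u v).symm
  · intro i v
    simp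
end

section
/- For all positive integers w and l, the complement of the graph Q(w,l) is a unit 3-track graph; that is, there exists a 3-track representation of the complement of Q(w,l) in which all intervals have the same length. -/
/-- Integer left endpoints of the intervals of the representation.  With `M` large, "level one"
is `2 * M`, which exceeds the common interval length `2 * M - 3` by three. -/
def qpos (w n : ℤ) : Fin 3 → ℤ → ℤ → ℤ := fun t cls q =>
  let M : ℤ := 100 * (n + w + 1)
  let s : ℤ := 8 * w + 8
  let xo := 8 * q + 2
  let xe := 8 * q - 2
  let a := 4 * q
  let b := 4 * q - 4
  let c := if q + 1 = 2 * n then 4 * q + 3 else 4 * q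
  let d := if q + 1 = 2 * n then 4 * q + 6 else 4 * q
  match t with
  | 0 => if cls = 0 then 2 * M + xo else if cls = 1 then 2 * M + xe else if cls = 2 then a
      else if cls = 3 then 4 * M + b + s else if cls = 4 then 2 * M + c else d
  | 1 => if cls = 0 then xo else if cls = 1 then 5 * M - xe else if cls = 2 then 2 * M + a
      else if cls = 3 then 3 * M - b else if cls = 4 then c else 5 * M - d
  | 2 => if cls = 0 then 2 * M + xo - s else if cls = 1 then 2 * M + xe
      else if cls = 2 then 4 * M + a
      else if cls = 3 then b else if cls = 4 then c else 2 * M + d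

/-- The (oriented) edges of `Q(w,l)`, in terms of classes and indices. -/
def qrel (w n c d p q : ℤ) : Prop :=
  (c = 0 ∧ d = 2 ∧ p + 1 ≤ n ∧ (q = 2 * p ∨ q = 2 * p + 1)) ∨
  (c = 0 ∧ d = 3 ∧ (q + 2 * w + 1 = 2 * p ∨ q + 2 * w = 2 * p)) ∨
  (c = 1 ∧ d = 2 ∧ (q + 1 = 2 * p ∨ q = 2 * p)) ∨
  (c = 1 ∧ d = 3 ∧ (q = 2 * p ∨ q = 2 * p + 1)) ∨
  (c = 2 ∧ d = 4 ∧ p = q ∧ p + 2 ≤ 2 * n) ∨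
  (c = 4 ∧ d = 5 ∧ p = q ∧ p + 2 ≤ 2 * n) ∨
  (c = 5 ∧ d = 3 ∧ q = p + 1)

/-- The class of a vertex, encoded as an integer. -/
def qcls {w l : ℕ} : QV w l → ℤ
  | Sum.inl _ => 0
  | Sum.inr (Sum.inl _) => 1
  | Sum.inr (Sum.inr (Sum.inl _)) => 2
  | Sum.inr (Sum.inr (Sum.inr (Sum.inl _))) => 3
  | Sum.inr (Sum.inr (Sum.inr (Sum.inr (Sum.inl _)))) => 4
  | Sum.inr (Sum.inr (Sum.inr (Sum.inr (Sum.inr _)))) => 5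

/-- The index of a vertex in its class. -/
def qidx {w l : ℕ} : QV w l → ℤ
  | Sum.inl p => p.val
  | Sum.inr (Sum.inl p) => p.val
  | Sum.inr (Sum.inr (Sum.inl p)) => p.val
  | Sum.inr (Sum.inr (Sum.inr (Sum.inl p))) => p.val
  | Sum.inr (Sum.inr (Sum.inr (Sum.inr (Sum.inl p)))) => p.val
  | Sum.inr (Sum.inr (Sum.inr (Sum.inr (Sum.inr p)))) => p.val

/-- Left endpoints for the vertices of `Q(w,l)`. -/
def qlo (w l : ℕ) (t : Fin 3) (v : QV w l) : ℤ := qpos w (w * l : ℕ) t (qcls v) (qidx v)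

/-- The common length of the intervals. -/
def qlen (w l : ℕ) : ℤ := 200 * ((w * l : ℕ) + w + 1) - 3

lemma qadj_iff (w l : ℕ) (u v : QV w l) (huv : u ≠ v) :
    (QGraph w l).Adj u v ↔
      (qrel w (w * l : ℕ) (qcls u) (qcls v) (qidx u) (qidx v) ∨
        qrel w (w * l : ℕ) (qcls v) (qcls u) (qidx v) (qidx u)) := by
  rw [QGraph, SimpleGraph.fromRel_adj, and_iff_right huv]
  have e2 : 2 * w * l = 2 * (w * l) := by ring
  clear huv
  rcases u with ⟨p, hp⟩ | ⟨p, hp⟩ | ⟨p, hp⟩ | ⟨p, hp⟩ | ⟨p, hp⟩ | ⟨p, hp⟩ <;>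
  rcases v with ⟨q, hq⟩ | ⟨q, hq⟩ | ⟨q, hq⟩ | ⟨q, hq⟩ | ⟨q, hq⟩ | ⟨q, hq⟩ <;>
  dsimp only [qrel, qcls, qidx] <;> simp only [e2] at hp hq ⊢ <;>
  generalize w * l = n at * <;>
  simp only [Int.reduceEq, OfNat.zero_ne_ofNat, zero_ne_one, one_ne_zero, OfNat.ofNat_ne_zero,
    OfNat.ofNat_ne_one, OfNat.one_ne_ofNat, false_and, true_and, and_false, false_or,
    or_false] <;> omega

lemma qvert (w l : ℕ) (u : QV w l) : 0 ≤ qidx u ∧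
    ((qcls u = 0 ∧ qidx u < (w * l : ℕ) + w) ∨ (qcls u = 1 ∧ qidx u < (w * l : ℕ)) ∨
     (qcls u = 2 ∧ qidx u < 2 * (w * l : ℕ)) ∨ (qcls u = 3 ∧ qidx u < 2 * (w * l : ℕ)) ∨
     (qcls u = 4 ∧ qidx u < 2 * (w * l : ℕ)) ∨ (qcls u = 5 ∧ qidx u < 2 * (w * l : ℕ))) := by
  have e1 : w * (l + 1) = w * l + w := by ring
  have e2 : 2 * w * l = 2 * (w * l) := by ring
  rcases u with ⟨p, hp⟩ | ⟨p, hp⟩ | ⟨p, hp⟩ | ⟨p, hp⟩ | ⟨p, hp⟩ | ⟨p, hp⟩ <;>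
  dsimp only [qcls, qidx] <;> (try simp only [e1, e2] at hp) <;>
  generalize w * l = n at * <;> omega

lemma qpos_key (w n c d p q : ℤ) (hw : 0 < w) (hn : 0 ≤ n) (hp : 0 ≤ p) (hq : 0 ≤ q)
    (hc : (c = 0 ∧ p < n + w) ∨ (c = 1 ∧ p < n) ∨ (c = 2 ∧ p < 2 * n) ∨ (c = 3 ∧ p < 2 * n) ∨
      (c = 4 ∧ p < 2 * n) ∨ (c = 5 ∧ p < 2 * n))
    (hd : (d = 0 ∧ q < n + w) ∨ (d = 1 ∧ q < n) ∨ (d = 2 ∧ q < 2 * n) ∨ (d = 3 ∧ q < 2 * n) ∨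
      (d = 4 ∧ q < 2 * n) ∨ (d = 5 ∧ q < 2 * n)) :
    ¬ (qrel w n c d p q ∨ qrel w n d c q p) ↔
      ∃ t, qpos w n t c p ≤ qpos w n t d q + (200 * (n + w + 1) - 3) ∧
        qpos w n t d q ≤ qpos w n t c p + (200 * (n + w + 1) - 3) := by
  have h3 : ∀ P : Fin 3 → Prop, (∃ t, P t) ↔ (P 0 ∨ P 1 ∨ P 2) := by
    intro P
    constructor
    · rintro ⟨t, ht⟩
      fin_cases t
      · exact Or.inl ht
      · exact Or.inr (Or.inl ht)
      · exact Or.inr (Or.inr ht)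
    · rintro (h | h | h) <;> exact ⟨_, h⟩
  rw [h3]
  obtain ⟨rfl, hc⟩ | ⟨rfl, hc⟩ | ⟨rfl, hc⟩ | ⟨rfl, hc⟩ | ⟨rfl, hc⟩ | ⟨rfl, hc⟩ := hc <;>
  obtain ⟨rfl, hd⟩ | ⟨rfl, hd⟩ | ⟨rfl, hd⟩ | ⟨rfl, hd⟩ | ⟨rfl, hd⟩ | ⟨rfl, hd⟩ := hd <;>
  simp only [qrel, qpos, reduceIte, Int.reduceEq, false_and, true_and, and_false, false_or,
    or_false, not_false_eq_true, true_iff] <;>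
  (try split_ifs) <;> omega

lemma qlo_key (w l : ℕ) (hw : 0 < w) (u v : QV w l) (huv : u ≠ v) :
    ¬ (QGraph w l).Adj u v ↔
      ∃ t, qlo w l t u ≤ qlo w l t v + qlen w l ∧ qlo w l t v ≤ qlo w l t u + qlen w l := by
  rw [qadj_iff w l u v huv]
  exact qpos_key w (w * l : ℕ) _ _ _ _ (by exact_mod_cast hw) (by positivity)
    (qvert w l u).1 (qvert w l v).1 (qvert w l u).2 (qvert w l v).2

/-- For all positive `w` and `l`, the complement of `Q(w,l)` is a unit 3-track graph. -/
theorem Q_compl_is_unit_three_track_graph (w l : ℕ) (hw : 0 < w) (hl : 0 < l) :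
    ∃ lo hi : Fin 3 → QV w l → ℝ,
      IsTTrackRep 3 (QGraph w l)ᶜ lo hi ∧ IsUnitRep 3 lo hi := by
  refine ⟨fun t v => (qlo w l t v : ℝ), fun t v => (qlo w l t v : ℝ) + (qlen w l : ℝ),
    ⟨fun t v => ?_, fun u v huv => ?_⟩, (qlen w l : ℝ), fun t v => by ring⟩
  · have : 0 ≤ qlen w l := by unfold qlen; omega
    have : (0 : ℝ) ≤ (qlen w l : ℝ) := by exact_mod_cast this
    linarith
  · rw [SimpleGraph.compl_adj, and_iff_right huv, qlo_key w l hw u v huv]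
    refine exists_congr fun t => ?_
    rw [Set.Icc_inter_Icc, Set.nonempty_Icc, sup_le_iff, le_inf_iff, le_inf_iff]
    have hL : 0 ≤ qlen w l := by unfold qlen; omega
    beta_reduce
    generalize qlo w l t u = x
    generalize qlo w l t v = y
    generalize qlen w l = L at hL ⊢
    have hL' : (0 : ℝ) ≤ (L : ℝ) := by exact_mod_cast hL
    constructor
    · rintro ⟨h1, h2⟩
      have h1' : (x : ℝ) ≤ y + L := by exact_mod_cast h1
      have h2' : (y : ℝ) ≤ x + L := by exact_mod_cast h2
      exact ⟨⟨by linarith, by linarith⟩, ⟨by linarith, by linarith⟩⟩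
    · rintro ⟨⟨-, h2⟩, ⟨h3, -⟩⟩
      first
        | exact ⟨by exact_mod_cast h2, by exact_mod_cast h3⟩
        | exact ⟨by exact_mod_cast h3, by exact_mod_cast h2⟩
end

section
/- For any finite simple graph G, the complement of the 3-subdivision Subd_3(G) is a 2-interval graph; that is, there exists a 2-interval representation of the complement of Subd_3(G). -/
/-- Left endpoints of the representation. -/
def subdLo {V E : Type*} (M C : ℤ) (F : V → ℤ) (h : E → ℤ) (l r : E → V) :
    Fin 2 → V ⊕ (E × Fin 3) → ℤ
  | 0, Sum.inl v => F v + M - C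
  | 1, Sum.inl v => F v + M
  | 0, Sum.inr (e, 0) => F (l e) + h e
  | 1, Sum.inr (_, 0) => 2 * C
  | 0, Sum.inr (e, 1) => F (r e) + h e + 1 - C
  | 1, Sum.inr (e, 1) => F (l e) + h e + 1
  | 0, Sum.inr (_, 2) => - 2 * C
  | 1, Sum.inr (e, 2) => F (r e) + h e + C

/-- Right endpoints of the representation. -/
def subdHi {V E : Type*} (C : ℤ) (F : V → ℤ) (h : E → ℤ) (l r : E → V) :
    Fin 2 → V ⊕ (E × Fin 3) → ℤ
  | 0, Sum.inl v => F v - 1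
  | 1, Sum.inl v => F v - 1 + C
  | 0, Sum.inr (e, 0) => F (l e) + h e
  | 1, Sum.inr (_, 0) => 2 * C
  | 0, Sum.inr (e, 1) => F (l e) + h e - 1
  | 1, Sum.inr (e, 1) => F (r e) + h e - 1 + C
  | 0, Sum.inr (e, 2) => F (r e) + h e - C
  | 1, Sum.inr (_, 2) => 2 * C

theorem meet_iff {W : Type*} (lo hi : Fin 2 → W → ℤ) (hle : ∀ i v, lo i v ≤ hi i v) (u v : W) :
    ((⋃ i, Set.Icc ((lo i u : ℤ) : ℝ) (hi i u : ℤ)) ∩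
      ⋃ j, Set.Icc ((lo j v : ℤ) : ℝ) (hi j v : ℤ)).Nonempty ↔
    ∃ i j, lo i u ≤ hi j v ∧ lo j v ≤ hi i u := by
  constructor
  · rintro ⟨x, hx, hy⟩
    simp only [Set.mem_iUnion, Set.mem_Icc] at hx hy
    obtain ⟨i, h1, h2⟩ := hx
    obtain ⟨j, h3, h4⟩ := hy
    exact ⟨i, j, by exact_mod_cast h1.trans h4, by exact_mod_cast h3.trans h2⟩
  · rintro ⟨i, j, h1, h2⟩
    refine ⟨((max (lo i u) (lo j v) : ℤ) : ℝ), ?_, ?_⟩ <;>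
      simp only [Set.mem_iUnion, Set.mem_Icc, Int.cast_le]
    · exact ⟨i, le_max_left _ _, max_le (hle i u) h2⟩
    · exact ⟨j, le_max_right _ _, max_le h1 (hle j v)⟩

/-- For any finite simple graph `G`, the complement of `Subd₃(G)` is a 2-interval graph. -/
theorem subd3_compl_is_two_interval_graph {V : Type*} [Fintype V] (G : SimpleGraph V)
    (l r : G.edgeSet → V) (hlr : ∀ e : G.edgeSet, (e : Sym2 V) = s(l e, r e)) :
    ∃ lo hi : Fin 2 → (V ⊕ (G.edgeSet × Fin 3)) → ℝ,
      IsTIntervalRep 2 (Subd 3 G l r)ᶜ lo hi := by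
  classical
  obtain ⟨M, h, hh0, hhM, hinj⟩ : ∃ (M : ℤ) (h : G.edgeSet → ℤ), (∀ e, 0 ≤ h e) ∧
      (0 < M ∧ ∀ e, h e < M) ∧ ∀ e e', e ≠ e' → h e ≠ h e' := by
    refine ⟨(Nat.card G.edgeSet : ℤ) + 1, fun e => ((Finite.equivFin G.edgeSet e : ℕ) : ℤ),
      fun e => by positivity, ⟨by positivity, fun e => ?_⟩, fun e e' hne he => hne ?_⟩
    · have := (Finite.equivFin G.edgeSet e).2
      simp only
      omega
    · apply (Finite.equivFin G.edgeSet).injective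
      apply Fin.ext
      simpa using he
  obtain ⟨hM, hhM⟩ := hhM
  obtain ⟨N, F, hN, hF0, hFN, hF⟩ : ∃ (N : ℤ) (F : V → ℤ), 0 ≤ N ∧ (∀ v, 0 ≤ F v) ∧
      (∀ v, F v + M ≤ N) ∧ ∀ u v, u ≠ v → F u + M ≤ F v ∨ F v + M ≤ F u := by
    refine ⟨(Nat.card V : ℤ) * M, fun v => ((Finite.equivFin V v : ℕ) : ℤ) * M, by positivity,
      fun v => by positivity, fun v => ?_, fun u v hne => ?_⟩
    · have := (Finite.equivFin V v).2
      have h2 : ((Finite.equivFin V v : ℕ) : ℤ) + 1 ≤ (Nat.card V : ℤ) := by omega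
      nlinarith
    · have h1 : ((Finite.equivFin V u : ℕ)) ≠ (Finite.equivFin V v : ℕ) :=
        fun he => hne ((Finite.equivFin V).injective (Fin.ext he))
      rcases lt_or_gt_of_ne h1 with h2 | h2
      · left
        have : ((Finite.equivFin V u : ℕ) : ℤ) + 1 ≤ (Finite.equivFin V v : ℕ) := by omega
        simp only
        nlinarith
      · right
        have : ((Finite.equivFin V v : ℕ) : ℤ) + 1 ≤ (Finite.equivFin V u : ℕ) := by omega
        simp only
        nlinarith
  obtain ⟨C, hC⟩ : ∃ C : ℤ, C = 3 * N + 10 := ⟨_, rfl⟩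
  have hle : ∀ i v, subdLo M C F h l r i v ≤ subdHi C F h l r i v := by
    rintro i (v | ⟨e, k⟩)
    · have := hF0 v
      have := hFN v
      fin_cases i <;> simp only [subdLo, subdHi, Fin.zero_eta, Fin.mk_one, Fin.isValue] <;> omega
    · have := hF0 (l e)
      have := hFN (l e)
      have := hF0 (r e)
      have := hFN (r e)
      have := hh0 e
      have := hhM e
      fin_cases i <;> fin_cases k <;>
        simp only [subdLo, subdHi, Fin.zero_eta, Fin.mk_one, Fin.isValue, Fin.reduceFinMk] <;> omega
  refine ⟨fun i v => (subdLo M C F h l r i v : ℤ), fun i v => (subdHi C F h l r i v : ℤ),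
    fun i v => Int.cast_le.mpr (hle i v), fun u v huv => ?_⟩
  rw [meet_iff _ _ hle]
  have hVE : ∀ (v : V) (e : G.edgeSet) (k : Fin 3),
      (¬ ((k.val = 0 ∧ v = l e) ∨ (k.val = 2 ∧ v = r e))) ↔
      ∃ i j, subdLo M C F h l r i (Sum.inl v) ≤ subdHi C F h l r j (Sum.inr (e, k)) ∧
        subdLo M C F h l r j (Sum.inr (e, k)) ≤ subdHi C F h l r i (Sum.inl v) := by
    intro v e k
    have := hF0 (l e)
    have := hFN (l e)
    have := hF0 (r e)
    have := hFN (r e)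
    have := hh0 e
    have := hhM e
    have := hF0 v
    have := hFN v
    have a1 := hF v (l e)
    have a2 := hF v (r e)
    fin_cases k <;>
      simp only [Fin.exists_fin_two, subdLo, subdHi, Fin.zero_eta, Fin.mk_one, Fin.isValue,
        Fin.reduceFinMk]
    · by_cases hv : v = l e
      · subst hv; simp; omega
      · have := a1 hv; simp [hv]; omega
    · simp; omega
    · by_cases hv : v = r e
      · subst hv; simp; omega
      · have := a2 hv; simp [hv]; omega
  rcases u with u | ⟨e, k⟩ <;> rcases v with v | ⟨e', k'⟩
  · have := hF0 u
    have := hF0 v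
    have := hFN u
    have := hFN v
    have hne : u ≠ v := fun hh => huv (by rw [hh])
    simp only [Subd, SimpleGraph.compl_adj, SimpleGraph.fromRel_adj, Fin.exists_fin_two, subdLo,
      subdHi]
    simp [hne]
    omega
  · rw [← hVE]
    simp [Subd, SimpleGraph.compl_adj, SimpleGraph.fromRel_adj]
  · have hs := hVE v e k
    refine Iff.trans (Iff.trans ?_ hs)
      ⟨fun ⟨i, j, p, q⟩ => ⟨j, i, q, p⟩, fun ⟨i, j, p, q⟩ => ⟨j, i, q, p⟩⟩
    simp [Subd, SimpleGraph.compl_adj, SimpleGraph.fromRel_adj]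
  · have := hF0 (l e)
    have := hFN (l e)
    have := hF0 (r e)
    have := hFN (r e)
    have := hh0 e
    have := hhM e
    have := hF0 (l e')
    have := hFN (l e')
    have := hF0 (r e')
    have := hFN (r e')
    have := hh0 e'
    have := hhM e'
    by_cases hee : e = e'
    · subst hee
      simp only [Subd, SimpleGraph.compl_adj, SimpleGraph.fromRel_adj, Fin.exists_fin_two]
      fin_cases k <;> fin_cases k' <;>
        simp only [subdLo, subdHi, Fin.zero_eta, Fin.mk_one, Fin.isValue, Fin.reduceFinMk] at huv ⊢ <;>
        simp at huv ⊢ <;> omega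
    · have hd := hinj _ _ hee
      have k1 : F (l e) + h e ≠ F (l e') + h e' := by
        by_cases hl : l e = l e'
        · rw [hl]; omega
        · have := hF _ _ hl; omega
      have k3 : F (r e) + h e ≠ F (r e') + h e' := by
        by_cases hl : r e = r e'
        · rw [hl]; omega
        · have := hF _ _ hl; omega
      simp only [Subd, SimpleGraph.compl_adj, SimpleGraph.fromRel_adj, Fin.exists_fin_two]
      fin_cases k <;> fin_cases k' <;>
        simp only [subdLo, subdHi, Fin.zero_eta, Fin.mk_one, Fin.isValue, Fin.reduceFinMk] at huv ⊢ <;>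
        simp [hee, Ne.symm hee] <;> omega
end

section
/- For any finite simple graph G, the complement of the 3-subdivision Subd_3(G) is a 2-circular track graph; that is, there exist two circles ℝ/c_1ℤ, ℝ/c_2ℤ and a 2-circular track representation of the complement of Subd_3(G) on them. -/
lemma arc_inter_iff_s14 (c p d q f : ℝ) :
    (Arc c p d ∩ Arc c q f).Nonempty ↔
      (0 ≤ d ∧ 0 ≤ f ∧ ∃ k : ℤ, p ≤ q + f + k * c ∧ q + k * c ≤ p + d) := by
  constructor
  · rintro ⟨z, ⟨x, ⟨hx1, hx2⟩, rfl⟩, ⟨y, ⟨hy1, hy2⟩, hxy⟩⟩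
    simp only at hxy
    have h2 : ((x - y : ℝ) : AddCircle c) = 0 := by
      rw [AddCircle.coe_sub, hxy, sub_self]
    obtain ⟨k, hk⟩ := (AddCircle.coe_eq_zero_iff c).1 h2
    rw [zsmul_eq_mul] at hk
    exact ⟨by linarith, by linarith, k, by linarith, by linarith⟩
  · rintro ⟨hd, hf, k, h1, h2⟩
    refine ⟨((max p (q + k * c) : ℝ) : AddCircle c),
      ⟨_, ⟨le_max_left _ _, max_le (by linarith) h2⟩, rfl⟩,
      ⟨max p (q + k * c) - k * c, ⟨?_, ?_⟩, ?_⟩⟩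
    · have := le_max_right p (q + k * c)
      linarith
    · have : max p (q + k * c) ≤ q + f + k * c := max_le h1 (by linarith)
      linarith
    · have h3 : ((k * c : ℝ) : AddCircle c) = 0 :=
        (AddCircle.coe_eq_zero_iff c).2 ⟨k, by rw [zsmul_eq_mul]⟩
      simp only [AddCircle.coe_sub, h3, sub_zero]

lemma arc_inter_of (c p d q f : ℝ) (hd : 0 ≤ d) (hf : 0 ≤ f)
    (h1 : p ≤ q + f) (h2 : q ≤ p + d) : (Arc c p d ∩ Arc c q f).Nonempty :=
  (arc_inter_iff_s14 _ _ _ _ _).2 ⟨hd, hf, 0, by simpa using h1, by simpa using h2⟩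

/-- the wrapped arc `[s, c+t]` is disjoint from `[p,p+f]` when `t < p` and `p+f < s` -/
lemma arc_disj_of (c s t p f : ℝ) (hc : 0 < c) (h1 : t < p) (h2 : p + f < s) :
    ¬ (Arc c s (c + t - s) ∩ Arc c p f).Nonempty := by
  rw [arc_inter_iff_s14]
  rintro ⟨-, -, k, h3, h4⟩
  have hk : (0 : ℝ) < k * c := by linarith
  have hk0 : (0 : ℝ) < k := pos_of_mul_pos_left hk hc.le
  have hk1 : (1 : ℝ) ≤ k := by
    have : (0 : ℤ) < k := by exact_mod_cast hk0
    exact_mod_cast this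
  nlinarith

lemma arc_wrap_inter (c s t p f : ℝ) (hs : s ≤ c + t) (hf : 0 ≤ f) (hp : 0 ≤ p + f)
    (hpc : p ≤ c + t) (hsc : s ≤ c + p + f) (h : p ≤ t ∨ s ≤ p + f) :
    (Arc c s (c + t - s) ∩ Arc c p f).Nonempty := by
  rw [arc_inter_iff_s14]
  refine ⟨by linarith, hf, ?_⟩
  rcases h with h | h
  · exact ⟨1, by push_cast; linarith, by push_cast; linarith⟩
  · exact ⟨0, by push_cast; linarith, by push_cast; linarith⟩

lemma one_track {V E : Type*} [Fintype V] [Fintype E] (l : E → V) :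
    ∃ (c : ℝ) (S D : V ⊕ (E × Fin 3) → ℝ) (I : V ⊕ (E × Fin 3) → V ⊕ (E × Fin 3) → Prop),
      (∀ u v, I u v ↔ (Arc c (S u) (D u) ∩ Arc c (S v) (D v)).Nonempty) ∧
      0 < c ∧ (∀ v, 0 ≤ D v ∧ D v < c) ∧
      (∀ u v, I u v ↔ I v u) ∧
      (∀ u v, I (.inl u) (.inl v)) ∧
      (∀ u e, I (.inl u) (.inr (e, 1))) ∧
      (∀ e e', I (.inr (e, 1)) (.inr (e', 1))) ∧
      (∀ e e', I (.inr (e, 0)) (.inr (e', 0))) ∧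
      (∀ e e', I (.inr (e, 0)) (.inr (e', 2))) ∧
      (∀ u e, ¬ I (.inl u) (.inr (e, 2))) ∧
      (∀ e e', ¬ I (.inr (e, 1)) (.inr (e', 2))) ∧
      (∀ u e, I (.inl u) (.inr (e, 0)) ↔ u ≠ l e) ∧
      (∀ e e', I (.inr (e, 1)) (.inr (e', 0)) ↔ e ≠ e') := by
  classical
  let n := Fintype.card V
  let m := Fintype.card E
  let φ : V → ℕ := fun v => (Fintype.equivFin V v).val
  let ψ : E → ℕ := fun e => (Fintype.equivFin E e).val
  have hφ : ∀ v, φ v < n := fun v => (Fintype.equivFin V v).2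
  have hψ : ∀ e, ψ e < m := fun v => (Fintype.equivFin E v).2
  have hφi : ∀ u v, φ u = φ v → u = v := fun u v h =>
    (Fintype.equivFin V).injective (Fin.ext h)
  have hψi : ∀ u v, ψ u = ψ v → u = v := fun u v h =>
    (Fintype.equivFin E).injective (Fin.ext h)
  clear_value φ ψ n m
  let X : V → ℕ := fun v => m * φ v
  let P : E → ℕ := fun e => X (l e) + ψ e
  let K : ℕ := m * n + 1
  have hX : ∀ v, X v + m + 1 ≤ K := by
    intro v
    have := Nat.mul_le_mul_left m (hφ v)
    simp only [X, K, Nat.mul_succ] at this ⊢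
    omega
  have hXX : ∀ u v, u ≠ v → X u + m ≤ X v ∨ X v + m ≤ X u := by
    intro u v huv
    have : φ u ≠ φ v := fun h => huv (hφi _ _ h)
    rcases lt_or_gt_of_ne this with h | h
    · left
      have := Nat.mul_le_mul_left m h
      simpa only [X, Nat.mul_succ] using this
    · right
      have := Nat.mul_le_mul_left m h
      simpa only [X, Nat.mul_succ] using this
  have hP : ∀ e, X (l e) ≤ P e ∧ P e + 1 ≤ X (l e) + m := by
    intro e
    have := hψ e
    simp only [P]
    omega
  have hPP : ∀ e e', e ≠ e' → P e + 1 ≤ P e' ∨ P e' + 1 ≤ P e := by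
    intro e e' h
    by_cases hl : l e = l e'
    · have : ψ e ≠ ψ e' := fun h' => h (hψi _ _ h')
      simp only [P, hl]
      omega
    · have h1 := hXX _ _ hl
      have h2 := hP e
      have h3 := hP e'
      omega
  have hXr : ∀ v, (X v : ℝ) + m + 1 ≤ K := fun v => by exact_mod_cast hX v
  have hXXr : ∀ u v, u ≠ v → (X u : ℝ) + m ≤ X v ∨ (X v : ℝ) + m ≤ X u :=
    fun u v h => by exact_mod_cast hXX u v h
  have hPr : ∀ e, (X (l e) : ℝ) ≤ P e ∧ (P e : ℝ) + 1 ≤ X (l e) + m :=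
    fun e => by exact_mod_cast hP e
  have hPPr : ∀ e e', e ≠ e' → (P e : ℝ) + 1 ≤ P e' ∨ (P e' : ℝ) + 1 ≤ P e :=
    fun u v h => by exact_mod_cast hPP u v h
  have hX0 : ∀ v, (0 : ℝ) ≤ X v := fun v => Nat.cast_nonneg _
  have hP0 : ∀ v, (0 : ℝ) ≤ P v := fun v => Nat.cast_nonneg _
  have hm1 : ∀ _ : E, (1 : ℝ) ≤ m := fun e => by
    have := hψ e
    exact_mod_cast (by omega : 1 ≤ m)
  have hm0 : (0 : ℝ) ≤ m := Nat.cast_nonneg _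
  have hK : (1 : ℝ) ≤ K := by exact_mod_cast (by simp [K] : 1 ≤ K)
  generalize (K : ℝ) = k at *
  generalize (m : ℝ) = μ at *
  let x : V → ℝ := fun v => X v
  let p : E → ℝ := fun e => P e
  change ∀ v, x v + μ + 1 ≤ k at hXr
  change ∀ u v, u ≠ v → x u + μ ≤ x v ∨ x v + μ ≤ x u at hXXr
  change ∀ e, x (l e) ≤ p e ∧ p e + 1 ≤ x (l e) + μ at hPr
  change ∀ e e', e ≠ e' → p e + 1 ≤ p e' ∨ p e' + 1 ≤ p e at hPPr
  change ∀ v, 0 ≤ x v at hX0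
  change ∀ v, 0 ≤ p v at hP0
  clear_value x p
  let c : ℝ := 2 * k + 2
  let S : V ⊕ (E × Fin 3) → ℝ := Sum.elim (fun v => x v + μ - 1/2 + k)
    (fun a => ![p a.1, p a.1 + k + 1/2, k] a.2)
  let D : V ⊕ (E × Fin 3) → ℝ := Sum.elim
    (fun v => c + (x v - 1/2) - (x v + μ - 1/2 + k))
    (fun a => ![k, c + (p a.1 - 1/2) - (p a.1 + k + 1/2), 0] a.2)
  have hPk : ∀ e, p e + 2 ≤ k := fun e => by
    have := hPr e; have := hXr (l e); linarith
  have hμ : ∀ v : V, μ + 1 ≤ k := fun v => by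
    have := hXr v; have := hX0 v; linarith
  have hc : c = 2 * k + 2 := rfl
  clear_value c
  refine ⟨c, S, D, _, fun u v => Iff.rfl, by linarith, ?_, ?_, ?_, ?_, ?_, ?_, ?_, ?_, ?_, ?_, ?_⟩
  · rintro (v | ⟨e, i⟩)
    · have := hμ v
      constructor <;> simp only [D, Sum.elim_inl] <;> linarith
    · fin_cases i <;> constructor <;> simp [D] <;> linarith
  · intro u v
    rw [Set.inter_comm]
  · intro u v
    have := hXr u; have := hXr v; have := hX0 u; have := hX0 v
    apply arc_inter_of <;> simp only [S, D, Sum.elim_inl] <;> linarith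
  · intro u e
    have := hXr u; have := hX0 u; have := hPk e; have := hP0 e
    apply arc_inter_of <;> simp [S, D] <;> linarith
  · intro e e'
    have := hPk e; have := hP0 e; have := hPk e'; have := hP0 e'
    apply arc_inter_of <;> simp [S, D] <;> linarith
  · intro e e'
    have := hPk e; have := hP0 e; have := hPk e'; have := hP0 e'
    apply arc_inter_of <;> simp [S, D] <;> linarith
  · intro e e'
    have := hPk e; have := hP0 e; have := hPk e'; have := hP0 e'
    apply arc_inter_of <;> simp [S, D] <;> linarith
  · intro u e
    have := hXr u; have := hX0 u; have := hm1 e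
    exact arc_disj_of c (x u + μ - 1/2 + k) (x u - 1/2) k 0 (by linarith) (by linarith) (by linarith)
  · intro e e'
    have := hPk e; have := hP0 e
    exact arc_disj_of c (p e + k + 1/2) (p e - 1/2) k 0 (by linarith) (by linarith) (by linarith)
  · intro u e
    have h1 := hXr u; have h2 := hX0 u; have h3 := hPk e; have h4 := hP0 e
    have h5 := hPr e
    constructor
    · rintro h rfl
      exact arc_disj_of c (x (l e) + μ - 1/2 + k) (x (l e) - 1/2) (p e) k (by linarith) (by linarith) (by linarith) h
    · intro h
      have h6 := hXXr _ _ h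
      refine arc_wrap_inter c (x u + μ - 1/2 + k) (x u - 1/2) (p e) k (by linarith) (by linarith) (by linarith)
        (by linarith) (by linarith) ?_
      rcases h6 with h6 | h6
      · right; linarith
      · left; linarith
  · intro e e'
    have := hPk e; have := hP0 e; have := hPk e'; have := hP0 e'
    constructor
    · rintro h rfl
      exact arc_disj_of c (p e + k + 1/2) (p e - 1/2) (p e) k (by linarith) (by linarith) (by linarith) h
    · intro h
      have h6 := hPPr _ _ h
      refine arc_wrap_inter c (p e + k + 1/2) (p e - 1/2) (p e') k (by linarith) (by linarith) (by linarith)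
        (by linarith) (by linarith) ?_
      rcases h6 with h6 | h6
      · right; linarith
      · left; linarith

set_option maxHeartbeats 1000000 in
/-- For any finite simple graph `G`, the complement of `Subd₃(G)` is a 2-circular track
graph. -/
theorem subd3_compl_is_two_circular_track_graph {V : Type*} [Fintype V]
    (G : SimpleGraph V) (l r : G.edgeSet → V)
    (hlr : ∀ e : G.edgeSet, (e : Sym2 V) = s(l e, r e)) :
    ∃ (c : Fin 2 → ℝ) (start len : Fin 2 → (V ⊕ (G.edgeSet × Fin 3)) → ℝ),
      IsTCircTrackRep 2 (Subd 3 G l r)ᶜ c start len := by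
  classical
  have : Fintype G.edgeSet := Fintype.ofFinite _
  obtain ⟨c, S, D, I, hI, hc, hD, sy, a1, a2, a3, a4, a5, a6, a7, a8, a9⟩ := one_track l
  obtain ⟨c', S', D', I', hI', hc', hD', sy', b1, b2, b3, b4, b5, b6, b7, b8, b9⟩ := one_track r
  let σ : V ⊕ (G.edgeSet × Fin 3) → V ⊕ (G.edgeSet × Fin 3) :=
    Sum.map id (Prod.map id Fin.rev)
  refine ⟨![c, c'], ![S, S' ∘ σ], ![D, D' ∘ σ], ?_, ?_, ?_⟩
  · intro i; fin_cases i <;> simpa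
  · intro i v
    fin_cases i
    · exact hD v
    · exact hD' (σ v)
  intro u v huv
  rw [Fin.exists_fin_two]
  change _ ↔ (Arc c (S u) (D u) ∩ Arc c (S v) (D v)).Nonempty ∨
    (Arc c' (S' (σ u)) (D' (σ u)) ∩ Arc c' (S' (σ v)) (D' (σ v))).Nonempty
  rw [← hI, ← hI', SimpleGraph.compl_adj]
  have r0 : Fin.rev (0 : Fin 3) = 2 := rfl
  have r1 : Fin.rev (1 : Fin 3) = 1 := rfl
  have r2 : Fin.rev (2 : Fin 3) = 0 := rfl
  rcases u with u | ⟨e, i⟩ <;> rcases v with v | ⟨e', j⟩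
  · simp [Subd, a1, huv]
  · fin_cases j
    · simp [Subd, σ, r0, a8, b6]
    · simp [Subd, σ, r1, a2]
    · simp [Subd, σ, r2, b8, a6]
  · rw [sy, sy']
    fin_cases i
    · simp [Subd, σ, r0, a8, b6]
    · simp [Subd, σ, r1, a2]
    · simp [Subd, σ, r2, b8, a6]
  · fin_cases i <;> fin_cases j
    · simp [Subd, a4] at huv ⊢; exact huv
    · rw [sy, sy']; simp [Subd, σ, r0, r1, a9, b7]; exact not_congr eq_comm
    · simp [Subd, a5]
    · simp [Subd, σ, r0, r1, a9, b7]; exact not_congr eq_comm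
    · simp [Subd, a3] at huv ⊢; exact huv
    · simp [Subd, σ, r1, r2, b9, a7]
    · rw [sy, sy']; simp [Subd, a5]
    · rw [sy, sy']; simp [Subd, σ, r1, r2, b9, a7]
    · simp [Subd, σ, r2, b4] at huv ⊢; exact huv
end

section
/- For any finite simple graph G with m edges, the independence number of the 2-subdivision satisfies α(Subd_2(G)) = α(G) + m. -/
/-- The independence number of a graph: the largest cardinality of a set of pairwise
non-adjacent vertices. -/
noncomputable def indepNum {V : Type*} (G : SimpleGraph V) : ℕ :=
  sSup {n : ℕ | ∃ s : Set V, (∀ u ∈ s, ∀ v ∈ s, u ≠ v → ¬ G.Adj u v) ∧ s.ncard = n}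

theorem indepNum_le_of {V : Type*} (G : SimpleGraph V) (k : ℕ)
    (h : ∀ s : Set V, (∀ u ∈ s, ∀ v ∈ s, u ≠ v → ¬ G.Adj u v) → s.ncard ≤ k) :
    indepNum G ≤ k := by
  apply csSup_le
  · exact ⟨0, ∅, by simp, by simp⟩
  · rintro n ⟨s, hs, rfl⟩
    exact h s hs

theorem le_indepNum_of {V : Type*} [Finite V] (G : SimpleGraph V) (s : Set V)
    (hs : ∀ u ∈ s, ∀ v ∈ s, u ≠ v → ¬ G.Adj u v) : s.ncard ≤ indepNum G := by
  apply le_csSup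
  · refine ⟨Nat.card V, ?_⟩
    rintro n ⟨t, _, rfl⟩
    exact Set.ncard_le_card t
  · exact ⟨s, hs, rfl⟩

theorem ncard_sum_split {α β : Type*} [Finite α] [Finite β] (A : Set α) (B : Set β) :
    (Sum.inl '' A ∪ Sum.inr '' B : Set (α ⊕ β)).ncard = A.ncard + B.ncard := by
  rw [Set.ncard_union_eq, Set.ncard_image_of_injective _ Sum.inl_injective,
    Set.ncard_image_of_injective _ Sum.inr_injective]
  rw [Set.disjoint_left]
  rintro x ⟨a, _, rfl⟩ ⟨b, _, hb⟩
  cases hb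

/-- For any finite simple graph `G` with `m` edges, `α(Subd₂(G)) = α(G) + m`. -/
theorem indepNum_subd2 {V : Type*} [Fintype V] (G : SimpleGraph V)
    (l r : G.edgeSet → V) (hlr : ∀ e : G.edgeSet, (e : Sym2 V) = s(l e, r e)) :
    indepNum (Subd 2 G l r) = indepNum G + G.edgeSet.ncard := by
  classical
  have hfin : Finite (Sym2 V) := inferInstance
  have hfe : Finite G.edgeSet := inferInstance
  apply le_antisymm
  · apply indepNum_le_of
    intro S hS
    let A : Set V := {v | Sum.inl v ∈ S}
    let B : Set (G.edgeSet × Fin 2) := {p | Sum.inr p ∈ S}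
    let bad : Set G.edgeSet := {e | l e ∈ A ∧ r e ∈ A}
    have hSeq : S = Sum.inl '' A ∪ Sum.inr '' B := by
      ext x
      cases x <;> simp [A, B]
    have h1 : ∀ e, Sum.inl (l e) ∈ S → Sum.inr (e, (0 : Fin 2)) ∈ S → False := by
      intro e ha hb
      exact hS _ ha _ hb (by simp) (by simp [Subd])
    have h2 : ∀ e, Sum.inl (r e) ∈ S → Sum.inr (e, (1 : Fin 2)) ∈ S → False := by
      intro e ha hb
      exact hS _ ha _ hb (by simp) (by simp [Subd])
    have h3 : ∀ e, Sum.inr (e, (0 : Fin 2)) ∈ S → Sum.inr (e, (1 : Fin 2)) ∈ S → False := by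
      intro e ha hb
      exact hS _ ha _ hb (by simp) (by simp [Subd])
    have hB : B.ncard ≤ badᶜ.ncard := by
      apply Set.ncard_le_ncard_of_injOn Prod.fst
      · rintro ⟨e, i⟩ hp ⟨hl, hr⟩
        fin_cases i
        · exact h1 e hl hp
        · exact h2 e hr hp
      · rintro ⟨e, i⟩ hp ⟨e', j⟩ hq (rfl : e = e')
        fin_cases i <;> fin_cases j
        · rfl
        · exact (h3 e hp hq).elim
        · exact (h3 e hq hp).elim
        · rfl
    have hA : (A \ l '' bad).ncard ≤ indepNum G := by
      apply le_indepNum_of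
      rintro u ⟨hu, hu'⟩ v ⟨hv, hv'⟩ _ huv
      have he := hlr ⟨s(u, v), huv⟩
      rcases Sym2.eq_iff.1 he with ⟨a, b⟩ | ⟨a, b⟩
      · exact hu' ⟨⟨s(u, v), huv⟩, ⟨a ▸ hu, b ▸ hv⟩, a.symm⟩
      · exact hv' ⟨⟨s(u, v), huv⟩, ⟨b ▸ hv, a ▸ hu⟩, b.symm⟩
    have hA2 : A.ncard ≤ (A \ l '' bad).ncard + (l '' bad).ncard :=
      Set.ncard_le_ncard_diff_add_ncard _ _
    have hl : (l '' bad).ncard ≤ bad.ncard := Set.ncard_image_le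
    have hc := Set.ncard_add_ncard_compl bad
    have hm : Nat.card G.edgeSet = G.edgeSet.ncard := rfl
    rw [hSeq, ncard_sum_split]
    omega
  · obtain ⟨A, hA, hAc⟩ : indepNum G ∈ {n : ℕ | ∃ s : Set V,
        (∀ u ∈ s, ∀ v ∈ s, u ≠ v → ¬ G.Adj u v) ∧ s.ncard = n} := by
      apply Nat.sSup_mem
      · exact ⟨0, ∅, by simp, by simp⟩
      · refine ⟨Nat.card V, ?_⟩
        rintro n ⟨t, _, rfl⟩
        exact Set.ncard_le_card t
    let f : G.edgeSet → G.edgeSet × Fin 2 := fun e => (e, if l e ∈ A then 1 else 0)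
    have hf : Function.Injective f := fun a b h => congrArg Prod.fst h
    have hr : (Set.range f).ncard = G.edgeSet.ncard := by
      rw [← Set.image_univ, Set.ncard_image_of_injective _ hf, Set.ncard_univ]
      rfl
    rw [← hAc, ← hr, ← ncard_sum_split]
    have hlrA : ∀ e, l e ∈ A → r e ∈ A → False := by
      intro e h1 h2
      have hadj : G.Adj (l e) (r e) := by
        have := e.2
        rw [hlr e] at this
        exact this
      exact hA _ h1 _ h2 hadj.ne hadj
    have key : ∀ v ∈ A, ∀ e, ¬ (Subd 2 G l r).Adj (Sum.inl v) (Sum.inr (f e)) := by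
      intro v hv e h
      by_cases hl : l e ∈ A
      · simp [Subd, f, hl] at h
        exact hlrA e hl (h ▸ hv)
      · simp [Subd, f, hl] at h
        exact hl (h ▸ hv)
    apply le_indepNum_of
    rintro _ (⟨u, hu, rfl⟩ | ⟨_, ⟨e, rfl⟩, rfl⟩) _ (⟨v, hv, rfl⟩ | ⟨_, ⟨e', rfl⟩, rfl⟩) hne hadj
    · simp [Subd] at hadj
    · exact key u hu e' hadj
    · exact key v hv e hadj.symm
    · rw [Subd, SimpleGraph.fromRel_adj] at hadj
      obtain ⟨_, ⟨h, _⟩ | ⟨h, _⟩⟩ := hadj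
      · exact hne (by rw [h])
      · exact hne (by rw [h])
end

section
/- Every t-circular interval graph is a (t+1)-interval graph: if a finite simple graph G admits a t-circular interval representation on some circle ℝ/cℤ, then G admits a (t+1)-interval representation on the real line. -/
/-- The part of `[0,c]` covered by the arcs of one vertex after cutting the circle at `0`. -/
def CutSet (t : ℕ) (c : ℝ) (p d : Fin t → ℝ) (x : ℝ) : Prop :=
  0 ≤ x ∧ x ≤ c ∧ ∃ i, (p i ≤ x ∧ x ≤ p i + d i) ∨ x + c ≤ p i + d i

lemma exists_cut (t : ℕ) (c : ℝ) (p d : Fin t → ℝ) (r : ℝ)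
    (hp : ∀ i, 0 ≤ p i ∧ p i < c) (hd : ∀ i, 0 ≤ d i ∧ d i < c) :
    ∃ lo hi : Fin (t + 1) → ℝ, (∀ i, lo i ≤ hi i) ∧
      ∀ x, x ≠ r → ((∃ i, lo i ≤ x ∧ x ≤ hi i) ↔ CutSet t c p d x) := by
  classical
  by_cases hw : ∃ i, c ≤ p i + d i
  · obtain ⟨i0, hi0, hmin⟩ := Finset.exists_min_image
      (Finset.univ.filter fun i => c ≤ p i + d i) p
      (by obtain ⟨i, hi⟩ := hw; exact ⟨i, by simpa using hi⟩)
    simp only [Finset.mem_filter, Finset.mem_univ, true_and] at hi0 hmin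
    refine ⟨Fin.cons (p i0) (fun i => if c ≤ p i + d i then 0 else p i),
      Fin.cons c (fun i => if c ≤ p i + d i then p i + d i - c else p i + d i), ?_, ?_⟩
    · intro i
      refine Fin.cases ?_ (fun i => ?_) i
      · simpa using (hp i0).2.le
      · simp only [Fin.cons_succ]
        have := hd i
        split_ifs <;> linarith
    · intro x _
      rw [Fin.exists_fin_succ]
      simp only [Fin.cons_zero, Fin.cons_succ]
      constructor
      · rintro (⟨h1, h2⟩ | ⟨i, h1, h2⟩)
        · exact ⟨(hp i0).1.trans h1, h2, i0, Or.inl ⟨h1, h2.trans hi0⟩⟩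
        · have := hd i
          have := hp i
          split_ifs at h1 h2 with hc
          · exact ⟨h1, by linarith, i, Or.inr (by linarith)⟩
          · exact ⟨by linarith, by linarith, i, Or.inl ⟨h1, h2⟩⟩
      · rintro ⟨h0, h1, i, ⟨h2, h3⟩ | h2⟩
        · by_cases hc : c ≤ p i + d i
          · exact Or.inl ⟨(hmin i hc).trans h2, h1⟩
          · exact Or.inr ⟨i, by simp [hc, h2, h3]⟩
        · have hc : c ≤ p i + d i := by linarith
          refine Or.inr ⟨i, ?_⟩
          rw [if_pos hc, if_pos hc]
          exact ⟨h0, by linarith⟩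
  · push Not at hw
    refine ⟨Fin.cons r p, Fin.cons r (fun i => p i + d i), ?_, ?_⟩
    · intro i
      refine Fin.cases ?_ (fun i => ?_) i
      · simp
      · simpa using (hd i).1
    · intro x hx
      rw [Fin.exists_fin_succ]
      simp only [Fin.cons_zero, Fin.cons_succ]
      constructor
      · rintro (⟨h1, h2⟩ | ⟨i, h1, h2⟩)
        · exact absurd (le_antisymm h2 h1) hx
        · have := hw i
          have := hp i
          exact ⟨by linarith, by linarith, i, Or.inl ⟨h1, h2⟩⟩
      · rintro ⟨h0, h1, i, ⟨h2, h3⟩ | h2⟩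
        · exact Or.inr ⟨i, h2, h3⟩
        · have := hw i
          linarith

lemma mem_arc_iff (c s d x : ℝ) :
    ((x : ℝ) : AddCircle c) ∈ Arc c s d ↔ ∃ k : ℤ, s ≤ x + k * c ∧ x + k * c ≤ s + d := by
  unfold Arc
  constructor
  · rintro ⟨y, ⟨h1, h2⟩, h⟩
    have h' : ((y : ℝ) : AddCircle c) = (x : ℝ) := h
    obtain ⟨k, hk⟩ := AddSubgroup.mem_zmultiples_iff.1 (QuotientAddGroup.eq.1 h'.symm)
    rw [zsmul_eq_mul] at hk
    have e : x + k * c = y := by linarith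
    exact ⟨k, by rw [e]; exact h1, by rw [e]; exact h2⟩
  · rintro ⟨k, h1, h2⟩
    refine ⟨x + k * c, ⟨h1, h2⟩, ?_⟩
    refine (QuotientAddGroup.eq.2 (AddSubgroup.mem_zmultiples_iff.2 ⟨k, ?_⟩)).symm
    rw [zsmul_eq_mul]
    ring

lemma mem_arc_cut (c s d x : ℝ) (hc : 0 < c) (hd : d < c) (hx : 0 ≤ x ∧ x < c) :
    ((x : ℝ) : AddCircle c) ∈ Arc c s d ↔
      (toIcoMod hc 0 s ≤ x ∧ x ≤ toIcoMod hc 0 s + d) ∨ x + c ≤ toIcoMod hc 0 s + d := by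
  rw [mem_arc_iff]
  have hs : toIcoMod hc 0 s + toIcoDiv hc 0 s * c = s := by
    have := toIcoMod_add_toIcoDiv_zsmul hc 0 s
    simpa using this
  have hm := toIcoMod_mem_Ico hc 0 s
  generalize toIcoMod hc 0 s = p at *
  generalize toIcoDiv hc 0 s = m at *
  obtain ⟨hm0, hm1⟩ := hm
  rw [zero_add] at hm1
  constructor
  · rintro ⟨k, h1, h2⟩
    obtain ⟨n, rfl⟩ : ∃ n, k = m + n := ⟨k - m, by ring⟩
    push_cast at h1 h2
    have a1 : p ≤ x + n * c := by nlinarith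
    have a2 : x + n * c ≤ p + d := by nlinarith
    have b1 : -1 < n := by
      by_contra hn
      have : (n : ℝ) ≤ -1 := by exact_mod_cast not_lt.mp hn
      nlinarith
    have b2 : n < 2 := by
      by_contra hn
      have : (2 : ℝ) ≤ n := by exact_mod_cast not_lt.mp hn
      nlinarith
    obtain rfl | rfl : n = 0 ∨ n = 1 := by omega
    · left; exact ⟨by simpa using a1, by simpa using a2⟩
    · right; simpa using a2
  · rintro (⟨h1, h2⟩ | h1)
    · exact ⟨m, by linarith, by linarith⟩
    · exact ⟨m + 1, by push_cast; linarith, by push_cast; linarith⟩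

/-- Every `t`-circular interval graph is a `(t+1)`-interval graph. -/
theorem circ_interval_to_interval {V : Type*} [Fintype V] (t : ℕ) (G : SimpleGraph V)
    (c : ℝ) (start len : Fin t → V → ℝ)
    (h : IsTCircIntervalRep t G c start len) :
    ∃ lo hi : Fin (t + 1) → V → ℝ, IsTIntervalRep (t + 1) G lo hi := by
  classical
  obtain ⟨hc, hl, hG⟩ := h
  let r : V → ℝ := fun v => c + 1 + ((Fintype.equivFin V v : ℕ) : ℝ)
  have hr : ∀ v, c < r v := fun v => by
    have : (0 : ℝ) ≤ ((Fintype.equivFin V v : ℕ) : ℝ) := Nat.cast_nonneg _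
    simp only [r]; linarith
  have hinj : ∀ u v, r u = r v → u = v := fun u v huv => by
    simp only [r, add_right_inj, Nat.cast_inj] at huv
    exact (Fintype.equivFin V).injective (Fin.ext huv)
  let p : V → Fin t → ℝ := fun v i => toIcoMod hc 0 (start i v)
  have hp : ∀ v i, 0 ≤ p v i ∧ p v i < c := fun v i => by
    have := toIcoMod_mem_Ico hc 0 (start i v)
    rw [zero_add] at this
    exact this
  choose lo hi hle hmem using fun v =>
    exists_cut t c (p v) (fun i => len i v) (r v) (hp v) (fun i => hl i v)
  refine ⟨fun i v => lo v i, fun i v => hi v i, fun i v => hle v i, ?_⟩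
  intro u v huv
  have key : ∀ w x, 0 ≤ x → x < c →
      (CutSet t c (p w) (fun i => len i w) x ↔
        ∃ i, ((x : ℝ) : AddCircle c) ∈ Arc c (start i w) (len i w)) := by
    intro w x h0 h1
    constructor
    · rintro ⟨-, -, i, h⟩
      exact ⟨i, (mem_arc_cut c _ _ x hc (hl i w).2 ⟨h0, h1⟩).2 h⟩
    · rintro ⟨i, h⟩
      exact ⟨h0, h1.le, i, (mem_arc_cut c _ _ x hc (hl i w).2 ⟨h0, h1⟩).1 h⟩
  have hzero : ∀ w, CutSet t c (p w) (fun i => len i w) c →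
      CutSet t c (p w) (fun i => len i w) 0 := by
    rintro w ⟨-, -, i, h⟩
    refine ⟨le_rfl, hc.le, i, Or.inr ?_⟩
    rcases h with h | h
    · simpa using h.2
    · simp only at h ⊢; linarith
  rw [hG u v huv]
  constructor
  · rintro ⟨i, j, y, hy1, hy2⟩
    obtain ⟨z, -, rfl⟩ := id hy1
    obtain ⟨x, hx0, hx1, hxz⟩ : ∃ x : ℝ, 0 ≤ x ∧ x < c ∧
        ((x : ℝ) : AddCircle c) = (z : ℝ) := by
      have := toIcoMod_mem_Ico hc 0 z
      rw [zero_add] at this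
      refine ⟨toIcoMod hc 0 z, this.1, this.2, ?_⟩
      refine QuotientAddGroup.eq.2 (AddSubgroup.mem_zmultiples_iff.2 ⟨toIcoDiv hc 0 z, ?_⟩)
      have := toIcoMod_add_toIcoDiv_zsmul hc 0 z
      linarith
    simp only [← hxz] at hy1 hy2
    have k1 := (hmem u x (by linarith [hr u])).2 ((key u x hx0 hx1).2 ⟨i, hy1⟩)
    have k2 := (hmem v x (by linarith [hr v])).2 ((key v x hx0 hx1).2 ⟨j, hy2⟩)
    exact ⟨x, by simpa using k1, by simpa using k2⟩
  · rintro ⟨x, hx1, hx2⟩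
    simp only [Set.mem_iUnion, Set.mem_Icc] at hx1 hx2
    obtain ⟨h1, h2⟩ : CutSet t c (p u) (fun i => len i u) x ∧
        CutSet t c (p v) (fun i => len i v) x := by
      by_cases e1 : x = r u
      · by_cases e2 : x = r v
        · exact absurd (hinj u v (e1.symm.trans e2)) huv
        · have := ((hmem v x e2).1 hx2).2.1
          linarith [hr u]
      · have h1 := (hmem u x e1).1 hx1
        refine ⟨h1, (hmem v x ?_).1 hx2⟩
        have := h1.2.1
        have := hr v
        intro e
        linarith
    obtain ⟨x, hxc, h1, h2⟩ : ∃ x, x < c ∧ CutSet t c (p u) (fun i => len i u) x ∧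
        CutSet t c (p v) (fun i => len i v) x := by
      rcases h1.2.1.lt_or_eq with h | h
      · exact ⟨x, h, h1, h2⟩
      · subst h
        exact ⟨0, hc, hzero u h1, hzero v h2⟩
    obtain ⟨i, hi'⟩ := (key u x h1.1 hxc).1 h1
    obtain ⟨j, hj'⟩ := (key v x h1.1 hxc).1 h2
    exact ⟨i, j, _, hi', hj'⟩
end

section
/- Every t-circular track graph is a 2t-interval graph: if a finite simple graph G admits a t-circular track representation on circles ℝ/c_1ℤ, …, ℝ/c_tℤ, then G admits a 2t-interval representation on the real line. -/
theorem circ_coe_eq (c x y : ℝ) :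
    (x : AddCircle c) = (y : AddCircle c) ↔ ∃ n : ℤ, y = x + n * c := by
  rw [eq_comm, ← sub_eq_zero, ← AddCircle.coe_sub, AddCircle.coe_eq_zero_iff]
  constructor
  · rintro ⟨n, hn⟩
    refine ⟨n, ?_⟩
    rw [zsmul_eq_mul] at hn
    linarith
  · rintro ⟨n, hn⟩
    refine ⟨n, ?_⟩
    rw [zsmul_eq_mul]
    linarith

theorem mem_Arc_iff (c p d x : ℝ) :
    (x : AddCircle c) ∈ Arc c p d ↔ ∃ n : ℤ, p ≤ x + n * c ∧ x + n * c ≤ p + d := by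
  constructor
  · rintro ⟨y, hy, hyx⟩
    obtain ⟨n, hn⟩ := (circ_coe_eq c x y).1 hyx.symm
    exact ⟨n, by rw [← hn]; exact hy.1, by rw [← hn]; exact hy.2⟩
  · rintro ⟨n, h1, h2⟩
    exact ⟨x + n * c, ⟨h1, h2⟩, ((circ_coe_eq c x _).2 ⟨n, rfl⟩).symm⟩

/-- Cutting an arc at the point `0` of the circle gives at most two intervals in `[0, c]`. -/
theorem arc_cut (c p d : ℝ) (hc : 0 < c) (hd : 0 ≤ d) (hdc : d < c) :
    ∃ lo hi : Fin 2 → ℝ, (∀ k, 0 ≤ lo k ∧ lo k ≤ hi k ∧ hi k ≤ c) ∧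
      (∀ k x, x ∈ Set.Icc (lo k) (hi k) → (x : AddCircle c) ∈ Arc c p d) ∧
      (∀ x, 0 ≤ x → x < c → (x : AddCircle c) ∈ Arc c p d →
        ∃ k, x ∈ Set.Icc (lo k) (hi k)) := by
  obtain ⟨m, q, hq0, hqc, rfl⟩ : ∃ (m : ℤ) (q : ℝ), 0 ≤ q ∧ q < c ∧ p = q + m * c := by
    refine ⟨⌊p / c⌋, p - ⌊p / c⌋ * c, ?_, ?_, by ring⟩
    · have := Int.floor_le (p / c)
      rw [le_div_iff₀ hc] at this
      linarith
    · have := Int.lt_floor_add_one (p / c)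
      rw [div_lt_iff₀ hc] at this
      linarith
  have key : ∀ x, 0 ≤ x → x < c → (x : AddCircle c) ∈ Arc c (q + m * c) d →
      (q ≤ x ∧ x ≤ q + d) ∨ x ≤ q + d - c := by
    intro x hx0 hxc hx
    obtain ⟨n, h1, h2⟩ := (mem_Arc_iff _ _ _ _).1 hx
    have e1 : (-1 : ℝ) < ((n - m : ℤ) : ℝ) := by
      push_cast
      by_contra hcon
      nlinarith
    have e2 : ((n - m : ℤ) : ℝ) < 2 := by
      push_cast
      by_contra hcon
      nlinarith
    have e3 : -1 < n - m := by exact_mod_cast e1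
    have e4 : n - m < 2 := by exact_mod_cast e2
    have : n = m ∨ n = m + 1 := by omega
    rcases this with rfl | rfl
    · left
      constructor <;> linarith
    · right
      push_cast at h2
      linarith
  by_cases hw : c ≤ q + d
  · refine ⟨![q, 0], ![c, q + d - c], ?_, ?_, ?_⟩
    · intro k
      fin_cases k <;> simp <;> (refine ⟨?_, ?_⟩ <;> linarith)
    · intro k x hx
      rw [mem_Arc_iff]
      fin_cases k <;> simp at hx
      · exact ⟨m, by linarith, by linarith⟩
      · refine ⟨m + 1, ?_, ?_⟩ <;> push_cast <;> linarith
    · intro x hx0 hxc hx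
      rcases key x hx0 hxc hx with h | h
      · exact ⟨0, by simp; constructor <;> linarith⟩
      · exact ⟨1, by simp; constructor <;> linarith⟩
  · refine ⟨fun _ => q, fun _ => q + d, ?_, ?_, ?_⟩
    · intro k
      refine ⟨?_, ?_, ?_⟩ <;> linarith
    · intro k x hx
      rw [mem_Arc_iff]
      exact ⟨m, by linarith [hx.1], by linarith [hx.2]⟩
    · intro x hx0 hxc hx
      rcases key x hx0 hxc hx with h | h
      · exact ⟨0, h⟩
      · linarith

/-- Every `t`-circular track graph is a `2t`-interval graph. -/
theorem circ_track_to_interval {V : Type*} [Fintype V] (t : ℕ) (G : SimpleGraph V)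
    (c : Fin t → ℝ) (start len : Fin t → V → ℝ)
    (h : IsTCircTrackRep t G c start len) :
    ∃ lo hi : Fin (2 * t) → V → ℝ, IsTIntervalRep (2 * t) G lo hi := by
  obtain ⟨hc, hl, hadj⟩ := h
  choose lo hi hb hin hout using fun i v =>
    arc_cut (c i) (start i v) (len i v) (hc i) (hl i v).1 (hl i v).2
  set M : ℝ := 1 + ∑ i, c i with hM
  have hcM : ∀ i, c i < M := by
    intro i
    have := Finset.single_le_sum (f := c) (fun j _ => (hc j).le) (Finset.mem_univ i)
    linarith
  have hsep : ∀ (i j : Fin t) (x y : ℝ), 0 ≤ x → x ≤ c i → 0 ≤ y → y ≤ c j →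
      x + M * (i : ℕ) = y + M * (j : ℕ) → (i : ℕ) ≤ j := by
    intro i j x y hx0 hx hy0 hy hxy
    by_contra hcon
    have h1 : ((j : ℕ) : ℝ) + 1 ≤ (i : ℕ) := by exact_mod_cast not_le.1 hcon
    have h2 := hcM j
    have h3 := hc j
    nlinarith
  let e := (finProdFinEquiv (m := 2) (n := t)).symm
  refine ⟨fun k v => lo (e k).2 v (e k).1 + M * ((e k).2 : ℕ),
    fun k v => hi (e k).2 v (e k).1 + M * ((e k).2 : ℕ), ?_, ?_⟩
  · intro k v
    have := (hb (e k).2 v (e k).1).2.1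
    linarith
  · intro u v huv
    rw [hadj u v huv]
    constructor
    · rintro ⟨i, z, hzu, hzv⟩
      obtain ⟨x, hx0, hxc, rfl⟩ : ∃ x : ℝ, 0 ≤ x ∧ x < c i ∧ (x : AddCircle (c i)) = z := by
        have : Fact (0 < c i) := ⟨hc i⟩
        obtain ⟨x, hx, hxz⟩ := AddCircle.coe_image_Ico_eq (c i) 0 ▸ Set.mem_univ z
        exact ⟨x, hx.1, by simpa using hx.2, hxz⟩
      obtain ⟨k, hk⟩ := hout i u x hx0 hxc hzu
      obtain ⟨l, hl'⟩ := hout i v x hx0 hxc hzv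
      refine ⟨x + M * (i : ℕ), Set.mem_iUnion.2 ⟨e.symm (k, i), ?_⟩,
        Set.mem_iUnion.2 ⟨e.symm (l, i), ?_⟩⟩
      · simp only [Equiv.apply_symm_apply]
        exact ⟨by linarith [hk.1], by linarith [hk.2]⟩
      · simp only [Equiv.apply_symm_apply]
        exact ⟨by linarith [hl'.1], by linarith [hl'.2]⟩
    · rintro ⟨z, hzu, hzv⟩
      obtain ⟨k, hk⟩ := Set.mem_iUnion.1 hzu
      obtain ⟨l, hl'⟩ := Set.mem_iUnion.1 hzv
      simp only [Set.mem_Icc] at hk hl'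
      generalize e k = a at hk
      generalize e l = b at hl'
      obtain ⟨k, i⟩ := a
      obtain ⟨l, j⟩ := b
      dsimp only at hk hl'
      obtain ⟨p1, p2, p3⟩ := hb i u k
      obtain ⟨q1, q2, q3⟩ := hb j v l
      have hij : i = j := by
        apply Fin.ext
        apply le_antisymm
        · exact hsep i j (z - M * (i : ℕ)) (z - M * (j : ℕ)) (by linarith) (by linarith)
            (by linarith) (by linarith) (by ring)
        · exact hsep j i (z - M * (j : ℕ)) (z - M * (i : ℕ)) (by linarith) (by linarith)
            (by linarith) (by linarith) (by ring)
      subst hij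
      exact ⟨i, ((z - M * (i : ℕ) : ℝ) : AddCircle (c i)),
        hin i u k _ ⟨by linarith, by linarith⟩, hin i v l _ ⟨by linarith, by linarith⟩⟩
end

section
/- There exists a unit 2-circular track representation of the complete graph K_5 on 5 vertices (all arcs of the same length, on two circles of the same circumference) such that on each of the two circles, the intersection graph of the five arcs is a 5-cycle, and the representation admits no transversal of size 2: there do not exist two points, each lying on one of the two circles, such that every vertex has an arc containing at least one of the two points. -/
/-- Equality in the circle. -/
lemma circ_coe_eq_iff (x y : ℝ) :
    ((y : AddCircle (10 : ℝ)) = (x : AddCircle (10 : ℝ))) ↔ ∃ k : ℤ, x = y + 10 * k := by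
  rw [eq_comm, ← sub_eq_zero, ← AddCircle.coe_sub, AddCircle.coe_eq_zero_iff]
  refine exists_congr fun k => ?_
  rw [zsmul_eq_mul]
  constructor <;> intro h <;> linarith

/-- Two arcs of length 3 on the circle of circumference 10 with starts `2m` and `2n` meet
iff `m - n` is `-1`, `0` or `1` modulo 5. -/
lemma arc_inter_iff_s18 (m n : ℤ) :
    (Arc 10 (2 * (m : ℝ)) 3 ∩ Arc 10 (2 * (n : ℝ)) 3).Nonempty ↔ (m - n + 1) % 5 ≤ 2 := by
  constructor
  · rintro ⟨_, ⟨x, ⟨hx1, hx2⟩, rfl⟩, ⟨y, ⟨hy1, hy2⟩, hxy⟩⟩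
    obtain ⟨k, hk⟩ := (circ_coe_eq_iff x y).1 hxy
    have h1 : 2 * m - 2 * n - 10 * k ≤ 3 := by
      have : (2 * m - 2 * n - 10 * k : ℝ) ≤ 3 := by linarith
      exact_mod_cast this
    have h2 : -3 ≤ 2 * m - 2 * n - 10 * k := by
      have : (-3 : ℝ) ≤ 2 * m - 2 * n - 10 * k := by linarith
      exact_mod_cast this
    omega
  · intro h
    obtain ⟨k, r, hr, h0, h2⟩ : ∃ k r : ℤ, m - n + 1 = 5 * k + r ∧ 0 ≤ r ∧ r ≤ 2 :=
      ⟨(m - n + 1) / 5, (m - n + 1) % 5, by omega, by omega, h⟩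
    have hr' : (m : ℝ) - n + 1 = 5 * k + r := by exact_mod_cast hr
    have h0' : (0 : ℝ) ≤ r := by exact_mod_cast h0
    have h2' : (r : ℝ) ≤ 2 := by exact_mod_cast h2
    refine ⟨((2 * m + (2 - r) * (3 / 2) : ℝ) : AddCircle (10 : ℝ)), ⟨_, ⟨?_, ?_⟩, rfl⟩,
      ⟨2 * m + (2 - r) * (3 / 2) - 10 * k, ⟨?_, ?_⟩, ?_⟩⟩
    · linarith
    · linarith
    · linarith
    · linarith
    · exact (circ_coe_eq_iff _ _).2 ⟨k, by ring⟩

/-- Half of the starting points. -/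
def halfStart (i : Fin 2) (v : Fin 5) : ℤ := ((i : ℕ) + 1 : ℤ) * ((v : ℕ) : ℤ)

/-- Combinatorial adjacency. -/
def circRel (i : Fin 2) (u v : Fin 5) : Prop := (halfStart i u - halfStart i v + 1) % 5 ≤ 2

instance (i : Fin 2) : DecidableRel (circRel i) := fun _ _ => by
  unfold circRel; infer_instance

lemma circ_connected (i : Fin 2) : (SimpleGraph.fromRel (circRel i)).Connected := by
  have hstep : ∀ u, (SimpleGraph.fromRel (circRel i)).Adj u (u + (if i = 0 then 1 else 3)) := by
    revert i; simp only [SimpleGraph.fromRel_adj]; decide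
  have h0 : ∀ n : ℕ, (SimpleGraph.fromRel (circRel i)).Reachable 0
      ((fun u : Fin 5 => u + (if i = 0 then 1 else 3))^[n] 0) := by
    intro n
    induction n with
    | zero => exact SimpleGraph.Reachable.refl _
    | succ n ih =>
      rw [Function.iterate_succ_apply']
      exact ih.trans (hstep _).reachable
  have hs : ∀ v : Fin 5, ∃ n : Fin 5,
      (fun u : Fin 5 => u + (if i = 0 then 1 else 3))^[(n : ℕ)] 0 = v := by
    clear h0 hstep; revert i; decide
  have hr : ∀ v, (SimpleGraph.fromRel (circRel i)).Reachable 0 v := by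
    intro v
    obtain ⟨n, hn⟩ := hs v
    exact hn ▸ h0 n
  exact ⟨fun u v => (hr u).symm.trans (hr v)⟩

lemma circ_degree (i : Fin 2) (v : Fin 5) :
    ((SimpleGraph.fromRel (circRel i)).neighborSet v).ncard = 2 := by
  have : (SimpleGraph.fromRel (circRel i)).neighborSet v
      = ((Finset.univ.filter fun u => v ≠ u ∧ (circRel i v u ∨ circRel i u v) : Finset (Fin 5)) :
          Set (Fin 5)) := by
    ext u; simp [SimpleGraph.fromRel_adj]
  rw [this, Set.ncard_coe_finset]
  clear this; revert i v; decide

/-- There is a unit 2-circular track representation of `K₅` (arcs of common length `d` on two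
circles of the same circumference `c`) such that the intersection graph of the arcs on each
circle is a 5-cycle (connected and 2-regular), and no two points (one on each circle) meet an
arc of every vertex. -/
theorem K5_unit_two_circular_track_no_size_two_transversal :
    ∃ (c d : ℝ) (start : Fin 2 → Fin 5 → ℝ),
      0 < c ∧ 0 ≤ d ∧ d < c ∧
      (∀ u v : Fin 5, u ≠ v →
        ((⊤ : SimpleGraph (Fin 5)).Adj u v ↔
          ∃ i : Fin 2, (Arc c (start i u) d ∩ Arc c (start i v) d).Nonempty)) ∧
      (∀ i : Fin 2,
        (SimpleGraph.fromRel fun u v : Fin 5 =>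
            (Arc c (start i u) d ∩ Arc c (start i v) d).Nonempty).Connected ∧
        ∀ v : Fin 5,
          ((SimpleGraph.fromRel fun u u' : Fin 5 =>
              (Arc c (start i u) d ∩ Arc c (start i u') d).Nonempty).neighborSet v).ncard
            = 2) ∧
      ¬ ∃ p q : AddCircle c, ∀ v : Fin 5,
          p ∈ Arc c (start 0 v) d ∨ q ∈ Arc c (start 1 v) d := by
  refine ⟨10, 3, fun i v => 2 * (halfStart i v : ℝ), by norm_num, by norm_num, by norm_num, ?_⟩
  simp only [arc_inter_iff_s18]
  refine ⟨?_, fun i => ⟨circ_connected i, circ_degree i⟩, ?_⟩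
  · simp only [SimpleGraph.top_adj]; decide
  · rintro ⟨p, q, h⟩
    have hp : ∀ u v, p ∈ Arc 10 (2 * (halfStart 0 u : ℝ)) 3 →
        p ∈ Arc 10 (2 * (halfStart 0 v : ℝ)) 3 → circRel 0 u v :=
      fun u v hu hv => (arc_inter_iff_s18 _ _).1 ⟨p, hu, hv⟩
    have hq : ∀ u v, q ∈ Arc 10 (2 * (halfStart 1 u : ℝ)) 3 →
        q ∈ Arc 10 (2 * (halfStart 1 v : ℝ)) 3 → circRel 1 u v :=
      fun u v hu hv => (arc_inter_iff_s18 _ _).1 ⟨q, hu, hv⟩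
    classical
    have key : ∀ S T : Finset (Fin 5), (∀ u ∈ S, ∀ v ∈ S, circRel 0 u v) →
        (∀ u ∈ T, ∀ v ∈ T, circRel 1 u v) → S ∪ T ≠ Finset.univ := by
      have c0 : ∀ S : Finset (Fin 5), (∀ u ∈ S, ∀ v ∈ S, circRel 0 u v) → S.card ≤ 2 := by decide
      have c1 : ∀ S : Finset (Fin 5), (∀ u ∈ S, ∀ v ∈ S, circRel 1 u v) → S.card ≤ 2 := by decide
      intro S T hS hT he
      have := Finset.card_union_le S T
      rw [he, Finset.card_univ, Fintype.card_fin] at this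
      have := c0 S hS
      have := c1 T hT
      omega
    refine key (Finset.univ.filter fun v => p ∈ Arc 10 (2 * (halfStart 0 v : ℝ)) 3)
      (Finset.univ.filter fun v => q ∈ Arc 10 (2 * (halfStart 1 v : ℝ)) 3) ?_ ?_ ?_
    · intro u hu v hv
      exact hp u v (Finset.mem_filter.1 hu).2 (Finset.mem_filter.1 hv).2
    · intro u hu v hv
      exact hq u v (Finset.mem_filter.1 hu).2 (Finset.mem_filter.1 hv).2
    · ext v
      simpa using h v
end
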